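/- arXiv:1705.00134 — 3 statements merged into one kernel-verified Lean document; each statement's English description precedes it below -/
import Mathlib

section
/- Let d ≥ 1, let Δ be a simplicial complex on the vertex set [d] = {1,...,d}, and let P_Δ ⊂ ℝ^d be the convex hull of the indicator vectors of the faces of Δ. Then the following conditions are equivalent: (i) Ω(O_P, P_Δ) has the integer decomposition property for some finite partially ordered set P on [d]; (ii) Ω(O_P, P_Δ) has the integer decomposition property for all finite partially ordered sets P on [d]; (iii) there exists a perfect graph G on [d] such that P_Δ equals the stable set polytope Q_G of G. -/
open scoped Pointwise

namespace HibiTsuchiya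

/-- A point of `ℝ^n` is a *lattice point* if all of its coordinates are integers. -/
def IsLatticePoint {n : ℕ} (x : Fin n → ℝ) : Prop := ∀ i, ∃ z : ℤ, x i = (z : ℝ)

/-- The dual polytope `P^∨ = {x : ⟨x,y⟩ ≤ 1 for all y ∈ P}`. -/
def dualPolytope {n : ℕ} (P : Set (Fin n → ℝ)) : Set (Fin n → ℝ) :=
  {x | ∀ y ∈ P, ∑ i, x i * y i ≤ 1}

/-- A polytope `P ⊆ ℝ^n` is *reflexive* if the origin is an interior point of `P` and the
dual polytope of `P` is again a lattice polytope (i.e. the convex hull of finitely many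
lattice points). -/
def IsReflexive {n : ℕ} (P : Set (Fin n → ℝ)) : Prop :=
  0 ∈ interior P ∧
    ∃ V : Finset (Fin n → ℝ), (∀ v ∈ V, IsLatticePoint v) ∧
      dualPolytope P = convexHull ℝ (V : Set (Fin n → ℝ))

/-- `P` has the *integer decomposition property* if every lattice point of `m • P` (`m ≥ 1`)
is a sum of `m` lattice points of `P`. -/
def HasIDP {n : ℕ} (P : Set (Fin n → ℝ)) : Prop :=
  ∀ m : ℕ, 0 < m → ∀ a : Fin n → ℝ, IsLatticePoint a → a ∈ (m : ℝ) • P →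
    ∃ f : Fin m → Fin n → ℝ, (∀ k, f k ∈ P ∧ IsLatticePoint (f k)) ∧ a = ∑ k, f k

/-- The indicator vector `ρ(S) = ∑_{j ∈ S} e_j` of a subset `S ⊆ [n]`. -/
noncomputable def indicator {n : ℕ} (S : Set (Fin n)) : Fin n → ℝ :=
  S.indicator (fun _ => (1 : ℝ))

/-- A poset ideal of a partial order `P` on `[n]`. -/
def IsPosetIdeal {n : ℕ} (P : PartialOrder (Fin n)) (I : Set (Fin n)) : Prop :=
  ∀ i ∈ I, ∀ j, P.le j i → j ∈ I

/-- The order polytope `O_P`: the convex hull of the indicator vectors of poset ideals. -/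
noncomputable def orderPolytope {n : ℕ} (P : PartialOrder (Fin n)) : Set (Fin n → ℝ) :=
  convexHull ℝ {x | ∃ I : Set (Fin n), IsPosetIdeal P I ∧ x = indicator I}

/-- An antichain of a partial order `P` on `[n]`: a pairwise incomparable subset. -/
def IsPosetAntichain {n : ℕ} (P : PartialOrder (Fin n)) (A : Set (Fin n)) : Prop :=
  ∀ i ∈ A, ∀ j ∈ A, i ≠ j → ¬ P.le i j ∧ ¬ P.le j i

/-- The chain polytope `C_P`: the convex hull of the indicator vectors of antichains. -/
noncomputable def chainPolytope {n : ℕ} (P : PartialOrder (Fin n)) : Set (Fin n → ℝ) :=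
  convexHull ℝ {x | ∃ A : Set (Fin n), IsPosetAntichain P A ∧ x = indicator A}

/-- A stable (independent) set of a graph. -/
def IsStableSet {V : Type*} (G : SimpleGraph V) (S : Set V) : Prop :=
  ∀ i ∈ S, ∀ j ∈ S, ¬ G.Adj i j

/-- The stable set polytope `Q_G`: the convex hull of the indicator vectors of stable sets. -/
noncomputable def stableSetPolytope {n : ℕ} (G : SimpleGraph (Fin n)) : Set (Fin n → ℝ) :=
  convexHull ℝ {x | ∃ S : Set (Fin n), IsStableSet G S ∧ x = indicator S}

/-- The clique number of a graph, as an extended natural number. -/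
noncomputable def cliqueNumber {V : Type*} (G : SimpleGraph V) : ℕ∞ :=
  ⨆ (t : Finset V) (_ : G.IsClique (t : Set V)), (t.card : ℕ∞)

/-- A graph is *perfect* if for every induced subgraph (including the graph itself)
the chromatic number equals the clique number. -/
def IsPerfectGraph {V : Type*} (G : SimpleGraph V) : Prop :=
  ∀ s : Set V, (G.induce s).chromaticNumber = cliqueNumber (G.induce s)

/-- A simplicial complex on the vertex set `[n]`. -/
def IsSimplicialComplex {n : ℕ} (Δ : Set (Finset (Fin n))) : Prop :=
  (∀ i : Fin n, {i} ∈ Δ) ∧ ∀ F ∈ Δ, ∀ F' ⊆ F, F' ∈ Δ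

/-- The polytope `P_Δ`: the convex hull of the indicator vectors of the faces of `Δ`. -/
noncomputable def complexPolytope {n : ℕ} (Δ : Set (Finset (Fin n))) : Set (Fin n → ℝ) :=
  convexHull ℝ {x | ∃ F ∈ Δ, x = indicator (↑F : Set (Fin n))}

/-- `Γ(P,Q) = conv(P ∪ (−Q))`. -/
noncomputable def gammaPolytope {n : ℕ} (P Q : Set (Fin n → ℝ)) : Set (Fin n → ℝ) :=
  convexHull ℝ (P ∪ -Q)

/-- `Ω(P,Q) = conv((P × {1}) ∪ ((−Q) × {−1})) ⊆ ℝ^{n+1}`. -/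
noncomputable def omegaPolytope {n : ℕ} (P Q : Set (Fin n → ℝ)) : Set (Fin (n+1) → ℝ) :=
  convexHull ℝ
    ((fun x : Fin n → ℝ => Fin.snoc x (1 : ℝ)) '' P ∪
     (fun x : Fin n → ℝ => Fin.snoc x (-1 : ℝ)) '' (-Q))

def ind {d : ℕ} (F : Finset (Fin d)) : Fin d → ℕ := fun i => if i ∈ F then 1 else 0

/-- `w` is a sum of `N` indicator vectors of members of `𝓕`. -/
def Cov {d : ℕ} (𝓕 : Set (Finset (Fin d))) (w : Fin d → ℕ) (N : ℕ) : Prop :=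
  ∃ L : List (Finset (Fin d)), L.length = N ∧ (∀ F ∈ L, F ∈ 𝓕) ∧ (L.map ind).sum = w

/-- Monotone integral sublinear functions. -/
structure Sublin {d : ℕ} (f : (Fin d → ℕ) → ℕ) : Prop where
  add : ∀ u v, f (u + v) ≤ f u + f v
  smul : ∀ (k : ℕ) v, f (k • v) = k * f v
  mono : ∀ u v, u ≤ v → f u ≤ f v

lemma sublin_step {d : ℕ} {f : (Fin d → ℕ) → ℕ} (hf : Sublin f) (w : Fin d → ℕ) :
    ∃ g, Sublin g ∧ (∀ v, g v ≤ f v) ∧ g w = f w ∧ (∀ v, g (v + w) = g v + g w) ∧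
      (∀ u, (∀ v, f (v + u) = f v + f u) → g u = f u ∧ ∀ v, g (v + u) = g v + g u) := by
  have hstab : ∀ v, ∃ c k0 : ℕ, ∀ k ≥ k0, f (v + k • w) = k * f w + c := by
    intro v
    have hge : ∀ k, k * f w ≤ f (v + k • w) := by
      intro k
      rw [← hf.smul]
      exact hf.mono _ _ (by intro i; simp)
    let h : ℕ → ℕ := fun k => f (v + k • w) - k * f w
    have hh : ∀ k, f (v + k • w) = k * f w + h k := by
      intro k
      have := hge k
      simp only [h]; omega
    have hanti : Antitone h := by
      apply antitone_nat_of_succ_le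
      intro k
      have h1 := hh k
      have h2 := hh (k+1)
      have h3 := hf.add (v + k • w) w
      have e : v + (k+1) • w = v + k • w + w := by rw [succ_nsmul, add_assoc]
      rw [e] at h2
      have : (k+1) * f w = k * f w + f w := by ring
      omega
    obtain ⟨n, hn⟩ : ∃ n, ∀ m, h n ≤ h m := by
      have hne : (Set.range h).Nonempty := ⟨_, 0, rfl⟩
      obtain ⟨n, hn⟩ := Nat.sInf_mem hne
      exact ⟨n, fun m => hn ▸ Nat.sInf_le ⟨m, rfl⟩⟩
    refine ⟨h n, n, fun k hk => ?_⟩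
    rw [hh k, le_antisymm (hanti hk) (hn k)]
  choose g k0 hg using hstab
  have g0 : g 0 = 0 := by
    have := hg 0 (k0 0) le_rfl
    rw [zero_add, hf.smul] at this
    omega
  refine ⟨g, ⟨?_, ?_, ?_⟩, ?_, ?_, ?_, ?_⟩
  · intro u v
    let k := max (k0 (u+v)) (max (k0 u) (k0 v))
    have h1 := hg (u+v) (2*k) (by simp only [k]; omega)
    have h2 := hg u k (by simp only [k]; omega)
    have h3 := hg v k (by simp only [k]; omega)
    have h4 := hf.add (u + k • w) (v + k • w)
    have e : u + v + (2*k) • w = (u + k • w) + (v + k • w) := by rw [two_mul, add_smul]; abel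
    rw [e] at h1
    have : 2 * k * f w = k * f w + k * f w := by ring
    omega
  · intro n v
    rcases Nat.eq_zero_or_pos n with rfl | hn
    · simp [g0]
    let k := max (k0 (n • v)) (k0 v)
    have h1 := hg (n • v) (n*k) (by
      have : k ≤ n * k := Nat.le_mul_of_pos_left k hn
      have : k0 (n • v) ≤ k := le_max_left _ _
      omega)
    have h2 := hg v k (by simp only [k]; omega)
    have e : n • v + (n*k) • w = n • (v + k • w) := by rw [smul_add, mul_smul]
    rw [e, hf.smul, h2] at h1
    have : n * (k * f w + g v) = n * k * f w + n * g v := by ring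
    omega
  · intro u v huv
    let k := max (k0 u) (k0 v)
    have h2 := hg u k (by simp only [k]; omega)
    have h3 := hg v k (by simp only [k]; omega)
    have := hf.mono (u + k • w) (v + k • w) (by gcongr)
    omega
  · intro v
    have h1 := hg v _ le_rfl
    have h2 := hf.add v (k0 v • w)
    rw [hf.smul] at h2
    omega
  · have h1 := hg w _ le_rfl
    have e : w + k0 w • w = (k0 w + 1) • w := by rw [succ_nsmul, add_comm]
    rw [e, hf.smul] at h1
    have : (k0 w + 1) * f w = k0 w * f w + f w := by ring
    omega
  · have hw : g w = f w := by
      have h1 := hg w _ le_rfl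
      have e : w + k0 w • w = (k0 w + 1) • w := by rw [succ_nsmul, add_comm]
      rw [e, hf.smul] at h1
      have : (k0 w + 1) * f w = k0 w * f w + f w := by ring
      omega
    intro v
    let k := max (k0 v) (k0 (v+w))
    have h1 := hg (v+w) k (by simp only [k]; omega)
    have h2 := hg v (k+1) (by simp only [k]; omega)
    have e : v + w + k • w = v + (k+1) • w := by rw [succ_nsmul]; abel
    rw [e] at h1
    have : (k + 1) * f w = k * f w + f w := by ring
    omega
  · intro u hu
    have key : ∀ v, g (v + u) = g v + f u := by
      intro v
      let k := max (k0 v) (k0 (v+u))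
      have h1 := hg (v+u) k (by simp only [k]; omega)
      have h2 := hg v k (by simp only [k]; omega)
      have e : v + u + k • w = v + k • w + u := by abel
      rw [e, hu] at h1
      omega
    have := key 0
    rw [zero_add, g0, zero_add] at this
    exact ⟨this, fun v => this ▸ key v⟩

lemma sublin_support {d : ℕ} {f : (Fin d → ℕ) → ℕ} (hf : Sublin f) (w : Fin d → ℕ) :
    ∃ b : Fin d → ℕ, (∀ v, ∑ i, b i * v i ≤ f v) ∧ ∑ i, b i * w i = f w := by
  have main : ∀ S : Finset (Fin d), ∃ g, Sublin g ∧ (∀ v, g v ≤ f v) ∧ g w = f w ∧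
      (∀ v, g (v + w) = g v + g w) ∧
      ∀ i ∈ S, ∀ v, g (v + Pi.single i 1) = g v + g (Pi.single i 1) := by
    intro S
    induction S using Finset.induction_on with
    | empty =>
      obtain ⟨g, h1, h2, h3, h4, -⟩ := sublin_step hf w
      exact ⟨g, h1, h2, h3, h4, by simp⟩
    | insert i S _ ih =>
      obtain ⟨g, h1, h2, h3, h4, h5⟩ := ih
      obtain ⟨g', k1, k2, k3, k4, k5⟩ := sublin_step h1 (Pi.single i 1)
      refine ⟨g', k1, fun v => (k2 v).trans (h2 v), ((k5 w h4).1).trans h3, (k5 w h4).2, ?_⟩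
      intro j hj
      rcases Finset.mem_insert.1 hj with rfl | hj
      · exact k4
      · exact (k5 _ (h5 j hj)).2
  obtain ⟨g, h1, h2, h3, -, h5⟩ := main Finset.univ
  have hlin : ∀ v, ∑ i, g (Pi.single i 1) * v i = g v := by
    intro v
    have g0 : g 0 = 0 := by simpa using h1.smul 0 0
    have hmul : ∀ (i : Fin d) (n : ℕ) u, g (u + Pi.single i n) = g u + g (Pi.single i 1) * n := by
      intro i n
      induction n with
      | zero => intro u; simp
      | succ n ih =>
        intro u
        rw [Pi.single_add, ← add_assoc, h5 i (Finset.mem_univ _), ih]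
        ring
    have : ∀ S : Finset (Fin d), g (∑ i ∈ S, Pi.single i (v i)) = ∑ i ∈ S, g (Pi.single i 1) * v i := by
      intro S
      induction S using Finset.induction_on with
      | empty => simp [g0]
      | insert i S hi ih => rw [Finset.sum_insert hi, Finset.sum_insert hi, add_comm, hmul, ih, add_comm]
    rw [← this Finset.univ, Finset.univ_sum_single]
  exact ⟨fun i => g (Pi.single i 1), fun v => (hlin v).le.trans (h2 v), (hlin w).trans h3⟩

lemma Cov.add {d : ℕ} {𝓕 : Set (Finset (Fin d))} {u v : Fin d → ℕ} {M N : ℕ}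
    (h1 : Cov 𝓕 u M) (h2 : Cov 𝓕 v N) : Cov 𝓕 (u + v) (M + N) := by
  obtain ⟨L, a, b, c⟩ := h1
  obtain ⟨L', a', b', c'⟩ := h2
  refine ⟨L ++ L', by simp [a, a'], ?_, by simp [c, c']⟩
  intro F hF
  rcases List.mem_append.1 hF with h | h
  · exact b _ h
  · exact b' _ h

lemma Cov.single {d : ℕ} {𝓕 : Set (Finset (Fin d))} {F : Finset (Fin d)} (h : F ∈ 𝓕) :
    Cov 𝓕 (ind F) 1 := ⟨[F], by simp, by simpa using h, by simp⟩

lemma Cov.zero {d : ℕ} {𝓕 : Set (Finset (Fin d))} : Cov 𝓕 0 0 := ⟨[], by simp, by simp, by simp⟩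

lemma ind_empty {d : ℕ} : ind (∅ : Finset (Fin d)) = 0 := by ext i; simp [ind]

lemma Cov.le {d : ℕ} {𝓕 : Set (Finset (Fin d))} (h0 : ∅ ∈ 𝓕) {u : Fin d → ℕ} {M N : ℕ}
    (h1 : Cov 𝓕 u M) (hMN : M ≤ N) : Cov 𝓕 u N := by
  induction hMN with
  | refl => exact h1
  | step _ ih => simpa [ind_empty] using ih.add (Cov.single h0)

lemma Cov.smul {d : ℕ} {𝓕 : Set (Finset (Fin d))} {u : Fin d → ℕ} {M : ℕ}
    (h1 : Cov 𝓕 u M) (k : ℕ) : Cov 𝓕 (k • u) (k * M) := by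
  induction k with
  | zero => simpa using Cov.zero
  | succ k ih => rw [succ_nsmul, Nat.succ_mul]; exact ih.add h1

/-- restricting a decomposition to a smaller vector, for down-closed families -/
lemma Cov.mono {d : ℕ} {𝓕 : Set (Finset (Fin d))} (hd : ∀ F ∈ 𝓕, ∀ F' ⊆ F, F' ∈ 𝓕)
    {u v : Fin d → ℕ} {N : ℕ} (h : Cov 𝓕 v N) (huv : u ≤ v) : Cov 𝓕 u N := by
  obtain ⟨L, a, b, c⟩ := h
  induction L generalizing u v N with
  | nil =>
    simp at a c
    subst a c
    have : u = 0 := le_antisymm huv (by intro i; simp)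
    subst this; exact Cov.zero
  | cons F L ih =>
    simp at a c b
    subst a c
    let F' : Finset (Fin d) := {i ∈ F | 0 < u i}
    have e : u = (u - ind F') + ind F' := by
      ext i
      by_cases hi : i ∈ F <;> by_cases hu : 0 < u i <;> simp [ind, F', hi, hu]
      omega
    rw [e]
    refine (ih (u := u - ind F') (v := (L.map ind).sum) ?_ rfl b.2 rfl).add (Cov.single (hd F b.1 _ (Finset.filter_subset _ _)))
    intro i
    have := huv i
    by_cases hi : i ∈ F <;> by_cases hu : 0 < u i <;> simp [ind, F', hi, hu] at this ⊢ <;> omega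

lemma exists_cov {d : ℕ} {𝓕 : Set (Finset (Fin d))} (hs : ∀ i, {i} ∈ 𝓕) (w : Fin d → ℕ) :
    ∃ N, Cov 𝓕 w N := by
  rw [← Finset.univ_sum_single w]
  generalize (Finset.univ : Finset (Fin d)) = S
  induction S using Finset.induction_on with
  | empty => exact ⟨0, Cov.zero⟩
  | insert i S hi ih =>
    obtain ⟨N, hN⟩ := ih
    rw [Finset.sum_insert hi]
    refine ⟨w i * 1 + N, Cov.add ?_ hN⟩
    · have := (Cov.single (hs i)).smul (w i)
      convert this using 1
      ext j
      by_cases h : j = i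
      · subst h; simp [ind]
      · simp [ind, h]

/-- The real vector associated to a natural vector. -/
def castv {d : ℕ} (w : Fin d → ℕ) : Fin d → ℝ := fun i => (w i : ℝ)

lemma indicator_coe {d : ℕ} (F : Finset (Fin d)) :
    indicator (↑F : Set (Fin d)) = castv (ind F) := by
  ext i
  by_cases h : i ∈ F <;> simp [indicator, castv, ind, h]

lemma castv_add {d : ℕ} (u v : Fin d → ℕ) : castv (u + v) = castv u + castv v := by
  ext i; simp [castv]

lemma castv_zero {d : ℕ} : castv (0 : Fin d → ℕ) = 0 := by
  ext i; simp [castv]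

lemma castv_ind_mem {d : ℕ} {Δ : Set (Finset (Fin d))} {F : Finset (Fin d)} (hF : F ∈ Δ) :
    castv (ind F) ∈ complexPolytope Δ :=
  subset_convexHull ℝ _ ⟨F, hF, (indicator_coe F).symm⟩

lemma convex_complexPolytope {d : ℕ} (Δ : Set (Finset (Fin d))) :
    Convex ℝ (complexPolytope Δ) := convex_convexHull _ _

lemma zero_mem_complexPolytope {d : ℕ} {Δ : Set (Finset (Fin d))} (h0 : ∅ ∈ Δ) :
    (0 : Fin d → ℝ) ∈ complexPolytope Δ := by
  have := castv_ind_mem h0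
  rwa [ind_empty, castv_zero] at this

lemma Cov.mem_smul {d : ℕ} {Δ : Set (Finset (Fin d))} (h0 : ∅ ∈ Δ) {w : Fin d → ℕ} {N : ℕ}
    (h : Cov Δ w N) : castv w ∈ (N : ℝ) • complexPolytope Δ := by
  obtain ⟨L, a, b, c⟩ := h
  induction L generalizing w N with
  | nil =>
    simp at a c
    subst a c
    exact ⟨0, zero_mem_complexPolytope h0, by simp [castv_zero]⟩
  | cons F L ih =>
    simp at a c b
    subst a c
    have h1 := ih rfl b.2 rfl
    have h2 : castv (ind F) ∈ (1 : ℝ) • complexPolytope Δ := by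
      rw [one_smul]; exact castv_ind_mem b.1
    push_cast
    rw [(convex_complexPolytope Δ).add_smul (by positivity) (by positivity), castv_add, add_comm (castv (ind F))]
    exact Set.add_mem_add h1 h2

lemma smul_mono {d : ℕ} {C : Set (Fin d → ℝ)} (hC : Convex ℝ C) (h0 : 0 ∈ C) {s t : ℝ}
    (hs : 0 ≤ s) (hst : s ≤ t) {x : Fin d → ℝ} (hx : x ∈ s • C) : x ∈ t • C := by
  obtain ⟨y, hy, rfl⟩ := hx
  rcases hs.eq_or_lt with rfl | hs
  · exact ⟨0, h0, by simp⟩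
  · have ht : 0 < t := hs.trans_le hst
    refine ⟨(s/t) • y, hC.smul_mem_of_zero_mem h0 hy ⟨by positivity, (div_le_one ht).2 hst⟩, ?_⟩
    simp only [smul_smul]
    congr 1
    field_simp

lemma boost {d : ℕ} {Δ : Set (Finset (Fin d))} (h0 : ∅ ∈ Δ)
    (H : ∀ (w : Fin d → ℕ) (q : ℕ), castv w ∈ ((q : ℝ) + 1/2) • complexPolytope Δ → Cov Δ w q)
    (n : ℕ) : ∀ (q : ℕ) (u : Fin d → ℕ),
      castv u ∈ ((q : ℝ) + 1 - (1/2)^(n+1)) • complexPolytope Δ → Cov Δ u q := by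
  induction n with
  | zero =>
    intro q u hu
    apply H
    convert hu using 2
    norm_num; ring
  | succ n ih =>
    intro q u hu
    have h2 : Cov Δ (2 • u) (2*q+1) := by
      apply ih
      obtain ⟨y, hy, e⟩ := hu
      refine ⟨y, hy, ?_⟩
      have : castv (2 • u) = (2:ℝ) • castv u := by ext i; simp [castv]
      rw [this, ← e]
      simp only [smul_smul]
      congr 1
      push_cast
      ring
    apply H
    obtain ⟨y, hy, e⟩ := h2.mem_smul h0
    refine ⟨y, hy, ?_⟩
    ext i
    have := congrFun e i
    simp [castv] at this ⊢
    linarith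

lemma boost' {d : ℕ} {Δ : Set (Finset (Fin d))} (h0 : ∅ ∈ Δ)
    (H : ∀ (w : Fin d → ℕ) (q : ℕ), castv w ∈ ((q : ℝ) + 1/2) • complexPolytope Δ → Cov Δ w q)
    (q : ℕ) (u : Fin d → ℕ) (t : ℝ) (ht0 : 0 ≤ t) (ht : t < q + 1)
    (hu : castv u ∈ t • complexPolytope Δ) : Cov Δ u q := by
  obtain ⟨n, hn⟩ := exists_pow_lt_of_lt_one (sub_pos.2 ht) (by norm_num : (1/2 : ℝ) < 1)
  apply boost h0 H n
  refine smul_mono (convex_complexPolytope Δ) (zero_mem_complexPolytope h0) ht0 ?_ hu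
  have : (1/2 : ℝ)^(n+1) ≤ (1/2)^n := by
    apply pow_le_pow_of_le_one <;> norm_num
  linarith

lemma clique_cover {d : ℕ} {Δ : Set (Finset (Fin d))} (hΔ : IsSimplicialComplex Δ) (h0 : ∅ ∈ Δ)
    (H : ∀ (w : Fin d → ℕ) (q : ℕ), castv w ∈ ((q : ℝ) + 1/2) • complexPolytope Δ → Cov Δ w q)
    (w : Fin d → ℕ) :
    ∃ K : Finset (Fin d), (∀ i ∈ K, ∀ j ∈ K, i ≠ j → ({i, j} : Finset (Fin d)) ∉ Δ) ∧
      Cov Δ w (∑ i ∈ K, w i) := by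
  classical
  have hex := exists_cov (𝓕 := Δ) hΔ.1
  let f : (Fin d → ℕ) → ℕ := fun v => Nat.find (hex v)
  have hcov : ∀ v, Cov Δ v (f v) := fun v => Nat.find_spec (hex v)
  have hmin : ∀ v N, Cov Δ v N → f v ≤ N := fun v N h => Nat.find_min' (hex v) h
  have hf : Sublin f := by
    refine ⟨fun u v => hmin _ _ ((hcov u).add (hcov v)), fun k v => ?_, fun u v h =>
      hmin _ _ ((hcov v).mono hΔ.2 h)⟩
    apply le_antisymm (hmin _ _ ((hcov v).smul k))
    by_contra hlt
    push Not at hlt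
    have hk : 0 < k := by
      rcases Nat.eq_zero_or_pos k with rfl | h
      · simp at hlt
      · exact h
    have hv : 0 < f v := by
      rcases Nat.eq_zero_or_pos (f v) with h | h
      · simp [h] at hlt
      · exact h
    have hkR : (0:ℝ) < k := by exact_mod_cast hk
    have hm : castv v ∈ ((f (k • v) : ℝ) / k) • complexPolytope Δ := by
      obtain ⟨y, hy, e⟩ := (hcov (k • v)).mem_smul h0
      refine ⟨y, hy, ?_⟩
      ext i
      have := congrFun e i
      simp [castv] at this ⊢
      field_simp
      linarith
    have := hmin _ _ (boost' h0 H (f v - 1) v _ (by positivity) (by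
      rw [div_lt_iff₀ hkR]
      have : ((f v - 1 : ℕ) : ℝ) + 1 = f v := by
        have : (f v - 1) + 1 = f v := by omega
        exact_mod_cast this
      rw [this, mul_comm]
      exact_mod_cast hlt) hm)
    omega
  obtain ⟨b, hb, hbw⟩ := sublin_support hf w
  have hface : ∀ F ∈ Δ, ∑ i ∈ F, b i ≤ 1 := by
    intro F hF
    have := (hb (ind F)).trans (hmin _ _ (Cov.single hF))
    simpa [ind] using this
  have hb1 : ∀ i, b i ≤ 1 := fun i => by simpa using hface _ (hΔ.1 i)
  refine ⟨Finset.univ.filter (fun i => b i = 1), ?_, ?_⟩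
  · intro i hi j hj hij hF
    simp at hi hj
    have := hface _ hF
    rw [Finset.sum_pair hij] at this
    omega
  · convert hcov w
    rw [← hbw, Finset.sum_filter]
    refine Finset.sum_congr rfl fun i _ => ?_
    have := hb1 i
    interval_cases b i <;> simp

lemma sum_ind_apply {d : ℕ} (L : List (Finset (Fin d))) (i : Fin d) :
    (L.map ind).sum i = L.countP (fun F => decide (i ∈ F)) := by
  induction L with
  | nil => simp
  | cons F L ih =>
    rw [List.map_cons, List.sum_cons, Pi.add_apply, ih, List.countP_cons, add_comm]
    simp [ind]

lemma cov_exists_mem {d : ℕ} {L : List (Finset (Fin d))} {i : Fin d}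
    (h : (L.map ind).sum i ≠ 0) : ∃ k : Fin L.length, i ∈ L.get k := by
  rw [sum_ind_apply] at h
  obtain ⟨F, hF, hi⟩ := List.countP_pos_iff.1 (Nat.pos_of_ne_zero h)
  obtain ⟨k, hk⟩ := List.get_of_mem hF
  exact ⟨k, hk ▸ by simpa using hi⟩

lemma perfect_of {d : ℕ} {Δ : Set (Finset (Fin d))} (hΔ : IsSimplicialComplex Δ) (h0 : ∅ ∈ Δ)
    (H : ∀ (w : Fin d → ℕ) (q : ℕ), castv w ∈ ((q : ℝ) + 1/2) • complexPolytope Δ → Cov Δ w q) :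
    ∃ G : SimpleGraph (Fin d), IsPerfectGraph G ∧ complexPolytope Δ = stableSetPolytope G := by
  classical
  let G : SimpleGraph (Fin d) :=
    { Adj := fun i j => i ≠ j ∧ ({i, j} : Finset (Fin d)) ∉ Δ
      symm := ⟨fun i j h => ⟨h.1.symm, by rw [Finset.pair_comm]; exact h.2⟩⟩
      loopless := ⟨fun i h => h.1 rfl⟩ }
  refine ⟨G, ?_, ?_⟩
  · intro s
    apply le_antisymm
    · obtain ⟨K, hK, L, hL, hLΔ, hsum⟩ := clique_cover hΔ h0 H (ind s.toFinset)
      have hc : ∀ v : s, ∃ k : Fin L.length, (v : Fin d) ∈ L.get k := by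
        intro v
        apply cov_exists_mem
        rw [hsum]
        simp [ind]
      choose c hc using hc
      have col : (G.induce s).Coloring (Fin L.length) := SimpleGraph.Coloring.mk c (by
        intro v w hvw heq
        have : G.Adj v w := hvw
        apply this.2
        refine hΔ.2 _ (hLΔ _ (List.get_mem L (c v))) _ ?_
        intro x hx
        rcases Finset.mem_insert.1 hx with rfl | hx
        · exact hc v
        · rw [Finset.mem_singleton.1 hx, heq]; exact hc w)
      have h1 : (G.induce s).chromaticNumber ≤ L.length := by
        simpa using col.colorable.chromaticNumber_le
      refine h1.trans ?_
      let t : Finset s := Finset.univ.filter (fun v => (v : Fin d) ∈ K)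
      have ht : (G.induce s).IsClique (t : Set s) := by
        intro v hv w hw hvw
        simp [t] at hv hw
        exact ⟨fun h => hvw (Subtype.ext h), hK _ hv _ hw (fun h => hvw (Subtype.ext h))⟩
      have hcard : t.card = L.length := by
        rw [hL]
        simp only [ind, Finset.sum_boole, Set.mem_toFinset, Nat.cast_id]
        rw [← Finset.card_map (Function.Embedding.subtype (· ∈ s))]
        congr 1
        ext x
        simp [t, and_comm]
      rw [← hcard]
      exact le_iSup₂_of_le (f := fun (t : Finset s) (_ : (G.induce s).IsClique (t : Set s)) =>
        (t.card : ℕ∞)) t ht le_rfl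
    · exact iSup₂_le fun t ht => ht.card_le_chromaticNumber
  · apply le_antisymm
    · apply convexHull_mono
      rintro x ⟨F, hF, rfl⟩
      refine ⟨F, ?_, rfl⟩
      intro i hi j hj hadj
      apply hadj.2
      refine hΔ.2 F hF _ ?_
      intro x hx
      rcases Finset.mem_insert.1 hx with rfl | hx
      · exact hi
      · rw [Finset.mem_singleton.1 hx]; exact hj
    · apply convexHull_mono
      rintro x ⟨S, hS, rfl⟩
      refine ⟨S.toFinset, ?_, by simp⟩
      obtain ⟨K, hK, hcov⟩ := clique_cover hΔ h0 H (ind S.toFinset)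
      have hle : ∑ i ∈ K, ind S.toFinset i ≤ 1 := by
        simp only [ind, Finset.sum_boole, Nat.cast_id]
        rw [Finset.card_le_one]
        intro a ha b hb
        simp at ha hb
        by_contra hab
        exact hS a ha.2 b hb.2 ⟨hab, hK a ha.1 b hb.1 hab⟩
      obtain ⟨L, hL, hLΔ, hsum⟩ := hcov.le h0 hle
      obtain ⟨F, rfl⟩ := List.length_eq_one_iff.1 hL
      simp at hsum hLΔ
      have : F = S.toFinset := by
        ext i
        have := congrFun hsum i
        simp only [ind] at this
        by_cases h1 : i ∈ F <;> by_cases h2 : i ∈ S.toFinset <;> simp [h1, h2] at this ⊢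
      exact this ▸ hLΔ

lemma complexPolytope_bounds {d : ℕ} {Δ : Set (Finset (Fin d))} {y : Fin d → ℝ}
    (hy : y ∈ complexPolytope Δ) (i : Fin d) : 0 ≤ y i ∧ y i ≤ 1 := by
  have : complexPolytope Δ ⊆ Set.pi Set.univ (fun _ => Set.Icc (0:ℝ) 1) := by
    apply convexHull_min
    · rintro x ⟨F, -, rfl⟩ i -
      rw [indicator_coe]
      by_cases h : i ∈ F <;> simp [castv, ind, h]
    · exact convex_pi fun i _ => convex_Icc 0 1
  exact this hy i (Set.mem_univ i)

lemma orderPolytope_bounds {d : ℕ} {P : PartialOrder (Fin d)} {y : Fin d → ℝ}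
    (hy : y ∈ orderPolytope P) (i : Fin d) : 0 ≤ y i ∧ y i ≤ 1 := by
  have : orderPolytope P ⊆ Set.pi Set.univ (fun _ => Set.Icc (0:ℝ) 1) := by
    apply convexHull_min
    · rintro x ⟨F, -, rfl⟩ i -
      by_cases h : i ∈ F <;> simp [indicator, h]
    · exact convex_pi fun i _ => convex_Icc 0 1
  exact this hy i (Set.mem_univ i)

lemma lattice_complexPolytope {d : ℕ} {Δ : Set (Finset (Fin d))} (hΔ : IsSimplicialComplex Δ)
    {y : Fin d → ℝ} (hy : y ∈ complexPolytope Δ) (hl : IsLatticePoint y) :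
    ∃ F ∈ Δ, y = castv (ind F) := by
  classical
  have h01 : ∀ i, y i = 0 ∨ y i = 1 := by
    intro i
    obtain ⟨z, hz⟩ := hl i
    obtain ⟨h1, h2⟩ := complexPolytope_bounds hy i
    rw [hz] at h1 h2 ⊢
    have h1 : 0 ≤ z := by exact_mod_cast h1
    have h2 : z ≤ 1 := by exact_mod_cast h2
    interval_cases z <;> simp
  let S : Finset (Fin d) := Finset.univ.filter (fun i => y i = 1)
  have hyS : y = castv (ind S) := by
    ext i
    rcases h01 i with h | h <;> simp [castv, ind, S, h]
  refine ⟨S, ?_, hyS⟩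
  by_contra hS
  have hsub : complexPolytope Δ ⊆ {x : Fin d → ℝ | (∑ i ∈ S, x i) ≤ (S.card : ℝ) - 1} := by
    apply convexHull_min
    · rintro x ⟨F, hF, rfl⟩
      rw [indicator_coe]
      have : ¬ S ⊆ F := fun h => hS (hΔ.2 F hF S h)
      obtain ⟨i, hiS, hiF⟩ := Finset.not_subset.1 this
      have hlt : (S.filter (· ∈ F)).card < S.card := by
        apply Finset.card_lt_card
        refine ⟨Finset.filter_subset _ _, fun h => ?_⟩
        exact hiF (Finset.mem_filter.1 (h hiS)).2
      have hlt' : ((S.filter (· ∈ F)).card : ℝ) + 1 ≤ S.card := by exact_mod_cast hlt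
      have : ∑ i ∈ S, castv (ind F) i = ((S.filter (· ∈ F)).card : ℝ) := by
        simp [castv, ind, Finset.filter_mem_eq_inter]
      simp only [Set.mem_ofPred_eq, this]
      linarith
    · have : IsLinearMap ℝ (fun x : Fin d → ℝ => ∑ i ∈ S, x i) :=
        ⟨fun x y => by simp [Finset.sum_add_distrib], fun c x => by simp [Finset.mul_sum]⟩
      exact convex_halfSpace_le this _
  have := hsub hy
  have e : ∑ i ∈ S, y i = S.card := by
    rw [Finset.sum_congr rfl (g := fun _ => (1:ℝ)) (fun i hi => (Finset.mem_filter.1 hi).2)]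
    simp [S]
  simp only [Set.mem_ofPred_eq, e] at this
  linarith

lemma mem_omega {d : ℕ} {A B : Set (Fin d → ℝ)} (hA : Convex ℝ A) (hB : Convex ℝ B)
    (hA0 : A.Nonempty) (hB0 : B.Nonempty) {z : Fin (d+1) → ℝ} :
    z ∈ omegaPolytope A B ↔ ∃ x ∈ A, ∃ y ∈ B, ∃ α β : ℝ, 0 ≤ α ∧ 0 ≤ β ∧ α + β = 1 ∧
      (∀ i : Fin d, z i.castSucc = α * x i - β * y i) ∧ z (Fin.last d) = α - β := by
  have hsn : ∀ (r : ℝ) (C : Set (Fin d → ℝ)), Convex ℝ C →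
      Convex ℝ ((fun x : Fin d → ℝ => (Fin.snoc x r : Fin (d+1) → ℝ)) '' C) := by
    rintro r C hC _ ⟨x, hx, rfl⟩ _ ⟨y, hy, rfl⟩ a b ha hb hab
    refine ⟨a • x + b • y, hC hx hy ha hb hab, ?_⟩
    ext i
    refine Fin.lastCases ?_ (fun i => ?_) i
    · simp [← add_mul, hab]
    · simp
  unfold omegaPolytope
  rw [(hsn 1 A hA).convexHull_union (hsn (-1) (-B) hB.neg) (hA0.image _) (hB0.neg.image _),
    mem_convexJoin]
  constructor
  · rintro ⟨_, ⟨x, hx, rfl⟩, _, ⟨y, hy, rfl⟩, α, β, hα, hβ, hab, rfl⟩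
    refine ⟨x, hx, -y, hy, α, β, hα, hβ, hab, fun i => by simp, ?_⟩
    simp
    ring
  · rintro ⟨x, hx, y, hy, α, β, hα, hβ, hab, h1, h2⟩
    refine ⟨_, ⟨x, hx, rfl⟩, _, ⟨-y, by simpa using hy, rfl⟩, α, β, hα, hβ, hab, ?_⟩
    ext i
    refine Fin.lastCases ?_ (fun i => ?_) i
    · simp [h2]; ring
    · simp [h1]; ring

lemma zero_mem_orderPolytope {d : ℕ} (P : PartialOrder (Fin d)) :
    (0 : Fin d → ℝ) ∈ orderPolytope P :=
  subset_convexHull ℝ _ ⟨∅, fun _ h => h.elim, by ext i; simp [indicator]⟩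

lemma convex_orderPolytope {d : ℕ} (P : PartialOrder (Fin d)) :
    Convex ℝ (orderPolytope P) := convex_convexHull _ _

lemma lattice_omega {d : ℕ} {P : PartialOrder (Fin d)} {Δ : Set (Finset (Fin d))}
    (hΔ : IsSimplicialComplex Δ) (h0 : ∅ ∈ Δ) {z : Fin (d+1) → ℝ}
    (hz : z ∈ omegaPolytope (orderPolytope P) (complexPolytope Δ)) (hl : IsLatticePoint z) :
    z (Fin.last d) = 1 ∨ z = 0 ∨
      (z (Fin.last d) = -1 ∧ ∃ F ∈ Δ, ∀ i : Fin d, z i.castSucc = - castv (ind F) i) := by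
  rw [mem_omega (convex_orderPolytope P) (convex_complexPolytope Δ) ⟨0, zero_mem_orderPolytope P⟩
    ⟨0, zero_mem_complexPolytope h0⟩] at hz
  obtain ⟨x, hx, y, hy, α, β, hα, hβ, hab, h1, h2⟩ := hz
  obtain ⟨n, hn⟩ := hl (Fin.last d)
  have hn1 : -1 ≤ n := by
    have : (-1 : ℝ) ≤ n := by linarith
    exact_mod_cast this
  have hn2 : n ≤ 1 := by
    have : (n : ℝ) ≤ 1 := by linarith
    exact_mod_cast this
  have hcase : n = -1 ∨ n = 0 ∨ n = 1 := by omega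
  rcases hcase with rfl | rfl | rfl
  · right; right
    push_cast at hn
    have ha : α = 0 := by linarith
    have hb : β = 1 := by linarith
    subst ha hb
    refine ⟨hn, ?_⟩
    obtain ⟨F, hF, rfl⟩ := lattice_complexPolytope hΔ hy (by
      intro i
      obtain ⟨k, hk⟩ := hl i.castSucc
      refine ⟨-k, ?_⟩
      rw [h1] at hk
      push_cast
      linarith)
    exact ⟨F, hF, fun i => by rw [h1]; ring⟩
  · right; left
    push_cast at hn
    have ha : α = 1/2 := by linarith
    have hb : β = 1/2 := by linarith
    subst ha hb
    ext i
    refine Fin.lastCases ?_ (fun i => ?_) i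
    · simp [hn]
    · obtain ⟨k, hk⟩ := hl i.castSucc
      have b1 := orderPolytope_bounds hx i
      have b2 := complexPolytope_bounds hy i
      have e := h1 i
      rw [hk] at e
      have k1 : -1 < k := by
        have : (-1 : ℝ) < k := by linarith
        exact_mod_cast this
      have k2 : k < 1 := by
        have : (k : ℝ) < 1 := by linarith
        exact_mod_cast this
      have : k = 0 := by omega
      rw [hk, this]; simp
  · left
    simpa using hn

lemma idp_imp {d : ℕ} {P : PartialOrder (Fin d)} {Δ : Set (Finset (Fin d))}
    (hΔ : IsSimplicialComplex Δ) (h0 : ∅ ∈ Δ)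
    (hI : HasIDP (omegaPolytope (orderPolytope P) (complexPolytope Δ)))
    (w : Fin d → ℕ) (q : ℕ) (hw : castv w ∈ ((q : ℝ) + 1/2) • complexPolytope Δ) :
    Cov Δ w q := by
  obtain ⟨y, hy, hyw⟩ := hw
  have hyw' : ∀ i, ((q:ℝ) + 1/2) * y i = w i := fun i => congrFun hyw i
  have hq : (0:ℝ) < q + 1 := by positivity
  obtain ⟨f, hf, hsum⟩ := hI (q+1) (by omega) (Fin.snoc (-castv w) (-(q:ℝ)))
    (by
      intro i
      refine Fin.lastCases ?_ (fun i => ?_) i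
      · exact ⟨-q, by simp⟩
      · exact ⟨-(w i), by simp [castv]⟩)
    (by
      refine ⟨((q + 1 : ℝ)⁻¹) • (Fin.snoc (-castv w) (-(q:ℝ)) : Fin (d+1) → ℝ), ?_, ?_⟩
      · rw [mem_omega (convex_orderPolytope P) (convex_complexPolytope Δ)
          ⟨0, zero_mem_orderPolytope P⟩ ⟨0, zero_mem_complexPolytope h0⟩]
        refine ⟨0, zero_mem_orderPolytope P, y, hy, (1/2)/(q+1), (q+1/2)/(q+1), by positivity,
          by positivity, by field_simp; ring, ?_, ?_⟩
        · intro i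
          simp [castv, ← hyw']
          field_simp
        · simp
          field_simp
          ring
      · simp only [smul_smul]
        push_cast
        rw [mul_inv_cancel₀ hq.ne', one_smul])
  have hcl := fun k => lattice_omega hΔ h0 (hf k).1 (hf k).2
  have hlast : ∑ k, f k (Fin.last d) = -(q:ℝ) := by
    have := congrFun hsum (Fin.last d)
    simp at this
    exact this.symm
  have hge : ∀ k, -1 ≤ f k (Fin.last d) := by
    intro k
    rcases hcl k with h | h | ⟨h, -⟩
    · rw [h]; norm_num
    · rw [h]; simp
    · rw [h]
  have hno : ∀ k, f k (Fin.last d) ≠ 1 := by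
    intro k hk
    have h1 := Finset.add_sum_erase Finset.univ (fun k => f k (Fin.last d)) (Finset.mem_univ k)
    have h2 := Finset.card_nsmul_le_sum (Finset.univ.erase k) (fun k => f k (Fin.last d)) (-1)
      (fun k _ => hge k)
    simp [Finset.card_erase_of_mem] at h2
    simp only [hk, hlast] at h1
    linarith
  have key : ∀ T : Finset (Fin (q+1)), ∃ (v : Fin d → ℕ) (N : ℕ), Cov Δ v N ∧
      (N : ℝ) = -∑ k ∈ T, f k (Fin.last d) ∧ ∀ i : Fin d, (v i : ℝ) = -∑ k ∈ T, f k i.castSucc := by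
    intro T
    induction T using Finset.induction_on with
    | empty => exact ⟨0, 0, Cov.zero, by simp, by simp⟩
    | insert k T hk ih =>
      obtain ⟨v, N, hc, hN, hv⟩ := ih
      rcases hcl k with h | h | ⟨h, F, hF, hFi⟩
      · exact absurd h (hno k)
      · exact ⟨v, N, hc, by simp [Finset.sum_insert hk, h, hN],
          fun i => by simp [Finset.sum_insert hk, h, hv]⟩
      · refine ⟨v + ind F, N + 1, hc.add (Cov.single hF), ?_, fun i => ?_⟩
        · rw [Finset.sum_insert hk, h]; push_cast; linarith
        · rw [Finset.sum_insert hk, hFi]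
          have := hv i
          simp only [Pi.add_apply, castv]
          push_cast
          linarith
  obtain ⟨v, N, hc, hN, hv⟩ := key Finset.univ
  have e1 : N = q := by
    rw [hlast, neg_neg] at hN
    exact_mod_cast hN
  have e2 : v = w := by
    ext i
    have h1 := hv i
    have h2 := congrFun hsum i.castSucc
    simp [castv] at h2
    rw [← h2, neg_neg] at h1
    exact_mod_cast h1
  exact e1 ▸ e2 ▸ hc

lemma cov_sum {d q : ℕ} {𝓕 : Set (Finset (Fin d))} (g : Fin q → Finset (Fin d))
    (hg : ∀ k, g k ∈ 𝓕) : Cov 𝓕 (∑ k, ind (g k)) q := by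
  refine ⟨List.ofFn g, by simp, ?_, ?_⟩
  · intro F hF
    obtain ⟨k, rfl⟩ := (List.mem_ofFn' g F).1 hF
    exact hg k
  · rw [List.map_ofFn, List.sum_ofFn]; rfl

lemma cov_split {d q : ℕ} {𝓕 : Set (Finset (Fin d))} {w : Fin d → ℕ} (h : Cov 𝓕 w q) {v : Fin d}
    (hv : w v ≠ 0) : ∃ S ∈ 𝓕, v ∈ S ∧ ∃ u M, q = M + 1 ∧ Cov 𝓕 u M ∧ w = u + ind S := by
  classical
  obtain ⟨L, hL, hLF, rfl⟩ := h
  obtain ⟨k, hk⟩ := cov_exists_mem hv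
  have hm : L.get k ∈ L := List.get_mem L k
  have hp := List.perm_cons_erase hm
  refine ⟨L.get k, hLF _ hm, hk, ((L.erase (L.get k)).map ind).sum, (L.erase (L.get k)).length,
    ?_, ⟨_, rfl, fun F hF => hLF F (List.mem_of_mem_erase hF), rfl⟩, ?_⟩
  · rw [← hL, hp.length_eq]; simp
  · rw [(hp.map ind).sum_eq]
    simp [add_comm]

lemma clique_le {d : ℕ} {G : SimpleGraph (Fin d)} {K : Finset (Fin d)}
    (hK : G.IsClique (K : Set (Fin d))) {S : Set (Fin d)}
    [DecidablePred (fun i => i ∈ S)] (hS : IsStableSet G S) :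
    (K.filter (fun i => i ∈ S)).card ≤ 1 := by
  rw [Finset.card_le_one]
  intro a ha b hb
  rw [Finset.mem_filter] at ha hb
  by_contra hab
  exact hS a ha.2 b hb.2 (hK ha.1 hb.1 hab)

/-- Finite stable sets. -/
def stab {d : ℕ} (G : SimpleGraph (Fin d)) : Set (Finset (Fin d)) :=
  {F | IsStableSet G (F : Set (Fin d))}

lemma Cov.clique_le {d : ℕ} {G : SimpleGraph (Fin d)} {K : Finset (Fin d)}
    (hK : G.IsClique (K : Set (Fin d))) {u : Fin d → ℕ} {M : ℕ} (h : Cov (stab G) u M) :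
    ∑ i ∈ K, u i ≤ M := by
  obtain ⟨L, a, b, c⟩ := h
  induction L generalizing u M with
  | nil => simp at a c; subst a c; simp
  | cons F L ih =>
    simp at a c b
    subst a c
    have h1 := ih rfl b.2 rfl
    have h2 := HibiTsuchiya.clique_le hK b.1
    have h3 : ∑ i ∈ K, ind F i ≤ 1 := by
      simpa [ind, Finset.filter_mem_eq_inter] using h2
    simp only [Pi.add_apply, Finset.sum_add_distrib]
    omega

lemma perfect_cov {d : ℕ} {G : SimpleGraph (Fin d)} (hG : IsPerfectGraph G) (n : ℕ) :
    ∀ (w : Fin d → ℕ) (q : ℕ), ∑ i, w i = n →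
      (∀ K : Finset (Fin d), G.IsClique (K : Set (Fin d)) → ∑ i ∈ K, w i ≤ q) →
      Cov (stab G) w q := by
  classical
  induction n using Nat.strong_induction_on with
  | _ n ih =>
  intro w q hn hw
  by_cases h2 : ∃ v, 2 ≤ w v
  · obtain ⟨v, hv⟩ := h2
    let w' : Fin d → ℕ := w - Pi.single v 1
    have hww' : w = w' + Pi.single v 1 := by
      ext i
      by_cases h : i = v
      · subst h; simp [w']; omega
      · simp [w', h]
    have hsum : ∑ i, w i = ∑ i, w' i + 1 := by
      conv_lhs => rw [hww']
      simp [Finset.sum_add_distrib]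
    have hc := ih (∑ i, w' i) (by omega) w' q rfl (fun K hK =>
      (Finset.sum_le_sum (fun i _ => by rw [hww']; simp)).trans (hw K hK))
    obtain ⟨S, hS, hvS, u, M, rfl, hu, hus⟩ := cov_split hc (v := v) (by simp [w']; omega)
    have hw2 : w = (u + Pi.single v 1) + ind S := by rw [hww', hus]; abel
    rw [hw2]
    refine Cov.add ?_ (Cov.single hS)
    refine ih (∑ i, (u + Pi.single v 1 : Fin d → ℕ) i) ?_ _ M rfl ?_
    · rw [← hn]
      apply Finset.sum_lt_sum
      · intro i _; rw [hw2]; simp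
      · exact ⟨v, Finset.mem_univ _, by conv_rhs => rw [hw2]
                                        simp [ind, hvS]⟩
    · intro K hK
      by_cases hvK : v ∈ K
      · have h1 := hw K hK
        have h3 : 1 ≤ ∑ i ∈ K, ind S i := by
          calc 1 = ind S v := by simp [ind, hvS]
            _ ≤ _ := Finset.single_le_sum (f := ind S) (fun _ _ => Nat.zero_le _) hvK
        rw [hw2] at h1
        simp only [Pi.add_apply (u + Pi.single v 1 : Fin d → ℕ), Finset.sum_add_distrib (g := ind S)] at h1
        omega
      · have h1 := hu.clique_le hK
        refine le_trans (le_of_eq ?_) h1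
        apply Finset.sum_congr rfl
        intro i hi
        have : i ≠ v := fun h => hvK (h ▸ hi)
        simp [this]
  · push Not at h2
    let W : Set (Fin d) := {i | w i = 1}
    have hchi : (G.induce W).chromaticNumber ≤ q := by
      rw [hG W]
      refine iSup₂_le fun t ht => ?_
      have hcl : G.IsClique ((t.map (Function.Embedding.subtype (· ∈ W)) : Finset (Fin d)) : Set (Fin d)) := by
        intro a ha b hb hab
        simp at ha hb
        obtain ⟨ha, ha'⟩ := ha
        obtain ⟨hb, hb'⟩ := hb
        exact ht ha' hb' (fun h => hab (congrArg Subtype.val h))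
      have := hw _ hcl
      rw [Finset.sum_map, Finset.sum_congr rfl (g := fun _ => 1) (fun i _ => i.2)] at this
      simp at this
      exact_mod_cast this
    obtain ⟨c⟩ := SimpleGraph.chromaticNumber_le_iff_colorable.1 hchi
    have := cov_sum (𝓕 := stab G)
      (fun k : Fin q => Finset.univ.filter (fun i => ∃ h : i ∈ W, c ⟨i, h⟩ = k)) (by
        intro k a ha b hb hab
        simp at ha hb
        obtain ⟨ha, ha'⟩ := ha
        obtain ⟨hb, hb'⟩ := hb
        have hadj : (G.induce W).Adj ⟨a, ha⟩ ⟨b, hb⟩ := hab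
        exact c.valid hadj (ha'.trans hb'.symm))
    convert this using 1
    ext i
    rw [Finset.sum_apply]
    by_cases hi : i ∈ W
    · have hi' : w i = 1 := hi
      simp [ind, hi, hi']
    · have hi' : w i ≠ 1 := hi
      have := h2 i
      simp [ind, hi]
      omega

/-- Finite poset ideals. -/
def ideals {d : ℕ} (P : PartialOrder (Fin d)) : Set (Finset (Fin d)) :=
  {F | IsPosetIdeal P (F : Set (Fin d))}

lemma ideals_cov {d : ℕ} (P : PartialOrder (Fin d)) (X : Fin d → ℕ) (p : ℕ) (hp : ∀ i, X i ≤ p)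
    (hX : ∀ i j, P.le j i → X i ≤ X j) : Cov (ideals P) X p := by
  classical
  have := cov_sum (𝓕 := ideals P) (fun k : Fin p => Finset.univ.filter (fun i => (k : ℕ) < X i)) (by
    intro k i hi j hji
    simp at hi ⊢
    exact hi.trans_le (hX i j hji))
  convert this using 1
  ext i
  rw [Finset.sum_apply]
  simp only [ind, Finset.mem_filter, Finset.mem_univ, true_and]
  rw [Fin.sum_univ_eq_sum_range (fun k => if k < X i then 1 else 0) p]
  simp only [Finset.sum_boole, Nat.cast_id]
  have : (Finset.range p).filter (fun k => k < X i) = Finset.range (X i) := by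
    ext k
    have := hp i
    simp; omega
  rw [this]; simp

lemma orderPolytope_mono {d : ℕ} {P : PartialOrder (Fin d)} {y : Fin d → ℝ}
    (hy : y ∈ orderPolytope P) (i j : Fin d) (hji : P.le j i) : y i ≤ y j := by
  have : orderPolytope P ⊆ {x : Fin d → ℝ | x i - x j ≤ 0} := by
    apply convexHull_min
    · rintro x ⟨I, hI, rfl⟩
      have := hI i
      by_cases h : i ∈ I
      · have h' := hI i h j hji
        simp [indicator, h, h']
      · by_cases h' : j ∈ I <;> simp [indicator, h, h']
    · have : IsLinearMap ℝ (fun x : Fin d → ℝ => x i - x j) :=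
        ⟨fun x y => by simp; ring, fun c x => by simp; ring⟩
      exact convex_halfSpace_le this _
  have := this hy
  simp only [Set.mem_ofPred_eq] at this
  linarith

lemma stable_nonneg {d : ℕ} {G : SimpleGraph (Fin d)} {y : Fin d → ℝ}
    (hy : y ∈ stableSetPolytope G) (i : Fin d) : 0 ≤ y i := by
  have : stableSetPolytope G ⊆ Set.pi Set.univ (fun _ => Set.Ici (0:ℝ)) := by
    apply convexHull_min
    · rintro x ⟨F, -, rfl⟩ i -
      by_cases h : i ∈ F <;> simp [indicator, h]
    · exact convex_pi fun i _ => convex_Ici 0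
  exact this hy i (Set.mem_univ i)

lemma stable_clique {d : ℕ} {G : SimpleGraph (Fin d)} {y : Fin d → ℝ}
    (hy : y ∈ stableSetPolytope G) (K : Finset (Fin d)) (hK : G.IsClique (K : Set (Fin d))) :
    ∑ i ∈ K, y i ≤ 1 := by
  classical
  have : stableSetPolytope G ⊆ {x : Fin d → ℝ | (∑ i ∈ K, x i) ≤ 1} := by
    apply convexHull_min
    · rintro x ⟨S, hS, rfl⟩
      have h1 := clique_le hK hS
      have h2 : ∑ i ∈ K, indicator S i = ((K.filter (fun i => i ∈ S)).card : ℝ) := by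
        simp [indicator, Set.indicator_apply]
      simp only [Set.mem_ofPred_eq, h2]
      exact_mod_cast h1
    · have : IsLinearMap ℝ (fun x : Fin d → ℝ => ∑ i ∈ K, x i) :=
        ⟨fun x y => by simp [Finset.sum_add_distrib], fun c x => by simp [Finset.mul_sum]⟩
      exact convex_halfSpace_le this _
  exact this hy

lemma Cov.list {d : ℕ} {𝓕 : Set (Finset (Fin d))} {w : Fin d → ℕ} {N : ℕ} (h : Cov 𝓕 w N)
    {Q : Set (Fin (d+1) → ℝ)} (ε : ℤ)
    (hQ : ∀ F ∈ 𝓕, (Fin.snoc ((ε : ℝ) • castv (ind F)) (ε : ℝ) : Fin (d+1) → ℝ) ∈ Q) :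
    ∃ L : List (Fin (d+1) → ℝ), L.length = N ∧ (∀ z ∈ L, z ∈ Q ∧ IsLatticePoint z) ∧
      L.sum = Fin.snoc ((ε : ℝ) • castv w) ((ε : ℝ) * N) := by
  obtain ⟨L, a, b, c⟩ := h
  induction L generalizing w N with
  | nil =>
    simp at a c
    subst a c
    refine ⟨[], rfl, by simp, ?_⟩
    ext i
    refine Fin.lastCases ?_ (fun i => ?_) i <;> simp [castv]
  | cons F L ih =>
    simp at a c b
    subst a c
    obtain ⟨L', a', b', c'⟩ := ih rfl b.2 rfl
    refine ⟨_ :: L', by simp [a'], List.forall_mem_cons.2 ⟨⟨hQ F b.1, ?_⟩, b'⟩, ?_⟩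
    · intro i
      refine Fin.lastCases ?_ (fun i => ?_) i
      · exact ⟨ε, by simp⟩
      · exact ⟨ε * ind F i, by simp [castv]⟩
    · rw [List.sum_cons, c']
      ext i
      refine Fin.lastCases ?_ (fun i => ?_) i
      · simp; ring
      · simp [castv]; ring

lemma perfect_idp {d : ℕ} (P : PartialOrder (Fin d)) (G : SimpleGraph (Fin d))
    (hG : IsPerfectGraph G) : HasIDP (omegaPolytope (orderPolytope P) (stableSetPolytope G)) := by
  classical
  have hB0 : (0 : Fin d → ℝ) ∈ stableSetPolytope G :=
    subset_convexHull ℝ _ ⟨∅, fun _ h => h.elim, by ext i; simp [indicator]⟩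
  have hBc : Convex ℝ (stableSetPolytope G) := convex_convexHull _ _
  have hmem := @mem_omega d (orderPolytope P) (stableSetPolytope G) (convex_orderPolytope P) hBc
    ⟨0, zero_mem_orderPolytope P⟩ ⟨0, hB0⟩
  intro m hm a hl ha
  obtain ⟨z, hz, rfl⟩ := ha
  obtain ⟨x, hx, y, hy, α, β, hα, hβ, hab, h1, h2⟩ := hmem.1 hz
  choose A hA using hl
  have hmR : (0:ℝ) < m := by exact_mod_cast hm
  set s : ℝ := m * α with hs
  set t : ℝ := m * β with ht
  have hs0 : 0 ≤ s := by positivity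
  have ht0 : 0 ≤ t := by positivity
  have hst : s + t = m := by rw [hs, ht, ← mul_add, hab, mul_one]
  have hlast : s = t + A (Fin.last d) := by
    have := hA (Fin.last d)
    simp [h2] at this
    rw [hs, ht]; linarith
  have hco : ∀ i : Fin d, s * x i = t * y i + A i.castSucc := by
    intro i
    have := hA i.castSucc
    simp [h1] at this
    rw [hs, ht]; linarith
  have hx0 := fun i => orderPolytope_bounds hx i
  have hy0 := fun i => stable_nonneg hy i
  have hsx : ∀ i, 0 ≤ s * x i := fun i => mul_nonneg hs0 (hx0 i).1
  have hty : ∀ i, 0 ≤ t * y i := fun i => mul_nonneg ht0 (hy0 i)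
  -- floors shift by integers
  have hfl : ∀ (u v : ℝ) (k : ℤ), 0 ≤ u → 0 ≤ v → u = v + k →
      ((⌊u⌋₊ : ℕ) : ℝ) - (⌊v⌋₊ : ℕ) = k := by
    intro u v k hu hv huv
    have e1 : ((⌊u⌋₊ : ℕ) : ℤ) = ⌊u⌋ := Int.natCast_floor_eq_floor hu
    have e2 : ((⌊v⌋₊ : ℕ) : ℤ) = ⌊v⌋ := Int.natCast_floor_eq_floor hv
    have e3 : ⌊u⌋ = ⌊v⌋ + k := by rw [huv, Int.floor_add_intCast]
    have : ((⌊u⌋₊ : ℕ) : ℤ) - (⌊v⌋₊ : ℕ) = k := by omega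
    exact_mod_cast this
  have covX : Cov (ideals P) (fun i => ⌊s * x i⌋₊) ⌊s⌋₊ := by
    apply ideals_cov
    · intro i
      exact Nat.floor_le_floor (mul_le_of_le_one_right hs0 (hx0 i).2)
    · intro i j hji
      exact Nat.floor_le_floor (mul_le_mul_of_nonneg_left (orderPolytope_mono hx i j hji) hs0)
  have covY : Cov (stab G) (fun i => ⌊t * y i⌋₊) ⌊t⌋₊ := by
    apply perfect_cov hG _ _ _ rfl
    intro K hK
    apply Nat.le_floor
    push_cast
    calc ∑ i ∈ K, ((⌊t * y i⌋₊ : ℕ) : ℝ) ≤ ∑ i ∈ K, t * y i :=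
          Finset.sum_le_sum fun i _ => Nat.floor_le (hty i)
      _ = t * ∑ i ∈ K, y i := by rw [Finset.mul_sum]
      _ ≤ t := mul_le_of_le_one_right ht0 (stable_clique hy K hK)
  obtain ⟨L1, l1, m1, s1⟩ := covX.list (Q := omegaPolytope (orderPolytope P) (stableSetPolytope G)) 1 (by
    intro F hF
    rw [hmem]
    refine ⟨_, subset_convexHull ℝ _ ⟨_, hF, rfl⟩, 0, hB0, 1, 0, by simp, by simp, by simp, ?_, by simp⟩
    intro i
    simp [indicator_coe])
  obtain ⟨L2, l2, m2, s2⟩ := covY.list (Q := omegaPolytope (orderPolytope P) (stableSetPolytope G)) (-1) (by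
    intro F hF
    rw [hmem]
    refine ⟨0, zero_mem_orderPolytope P, _, subset_convexHull ℝ _ ⟨_, hF, rfl⟩, 0, 1, by simp, by simp, by simp, ?_, by simp⟩
    intro i
    simp [indicator_coe])
  have hpq : ⌊s⌋₊ + ⌊t⌋₊ ≤ m := by
    have e1 := Nat.floor_le hs0
    have e2 := Nat.floor_le ht0
    have : ((⌊s⌋₊ : ℕ) : ℝ) + (⌊t⌋₊ : ℕ) ≤ m := by linarith
    exact_mod_cast this
  have hzero : (0 : Fin (d+1) → ℝ) ∈ omegaPolytope (orderPolytope P) (stableSetPolytope G) := by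
    rw [hmem]
    exact ⟨0, zero_mem_orderPolytope P, 0, hB0, 1/2, 1/2, by norm_num, by norm_num, by norm_num,
      by simp, by simp⟩
  let L := L1 ++ L2 ++ List.replicate (m - (⌊s⌋₊ + ⌊t⌋₊)) 0
  have hLlen : L.length = m := by simp [L, l1, l2]; omega
  have hLsum : L.sum = (m : ℝ) • z := by
    simp only [L, List.sum_append, s1, s2, List.sum_replicate, smul_zero, add_zero]
    ext i
    rw [show ((m:ℝ) • z) i = A i from hA i]
    refine Fin.lastCases ?_ (fun i => ?_) i
    · rw [← hfl s t _ hs0 ht0 hlast]; simp; ring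
    · rw [← hfl _ _ _ (hsx i) (hty i) (hco i)]; simp [castv]; ring
  have hLmem : ∀ z ∈ L, z ∈ omegaPolytope (orderPolytope P) (stableSetPolytope G) ∧
      IsLatticePoint z := by
    intro z hz
    simp only [L, List.mem_append] at hz
    rcases hz with (hz | hz) | hz
    · exact m1 z hz
    · exact m2 z hz
    · rw [List.eq_of_mem_replicate hz]
      exact ⟨hzero, fun i => ⟨0, by simp⟩⟩
  clear_value L
  subst hLlen
  refine ⟨fun k => L.get k, fun k => hLmem _ (List.get_mem L k), ?_⟩
  show _ = ∑ k : Fin L.length, L[k.1]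
  rw [Fin.sum_univ_getElem, hLsum]

/-- **Proposition (Type Ω).** For a simplicial complex `Δ` on `[d]` (`d ≥ 1`),
the following are equivalent: (i) `Ω(O_P, P_Δ)` has the integer decomposition property
for some poset `P` on `[d]`; (ii) `Ω(O_P, P_Δ)` has the integer decomposition property
for all posets `P` on `[d]`; (iii) there is a perfect graph `G` on `[d]` with `P_Δ = Q_G`. -/
theorem omega_characterization (d : ℕ) (hd : 1 ≤ d) (Δ : Set (Finset (Fin d)))
    (hΔ : IsSimplicialComplex Δ) :
    List.TFAE
      [ (∃ P : PartialOrder (Fin d),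
          HasIDP (omegaPolytope (orderPolytope P) (complexPolytope Δ))),
        (∀ P : PartialOrder (Fin d),
          HasIDP (omegaPolytope (orderPolytope P) (complexPolytope Δ))),
        (∃ G : SimpleGraph (Fin d),
          IsPerfectGraph G ∧ complexPolytope Δ = stableSetPolytope G) ] := by
  have h0 : ∅ ∈ Δ := hΔ.2 _ (hΔ.1 ⟨0, hd⟩) _ (Finset.empty_subset _)
  tfae_have 1 → 3 := by
    rintro ⟨P, hP⟩
    exact perfect_of hΔ h0 (idp_imp hΔ h0 hP)
  tfae_have 3 → 2 := by
    rintro ⟨G, hG, e⟩ P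
    rw [e]
    exact perfect_idp P G hG
  tfae_have 2 → 1 := fun h => ⟨inferInstance, h _⟩
  tfae_finish

end HibiTsuchiya
end

section
/- Let d ≥ 1, let P be any finite partially ordered set on [d] = {1,...,d}, and let G be any perfect graph on [d]. Then Γ(O_P, Q_G) = conv(O_P ∪ (−Q_G)) ⊂ ℝ^d is a reflexive polytope with the integer decomposition property. -/
open scoped Pointwise

namespace HibiTsuchiya

open Classical in
/-- A clique meets a stable set in at most one vertex. -/
lemma clique_stable_nat {d : ℕ} (G : SimpleGraph (Fin d)) (C : Finset (Fin d))
    (hC : G.IsClique (C : Set (Fin d))) (S : Set (Fin d)) (hS : IsStableSet G S) :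
    ∑ i ∈ C, (if i ∈ S then 1 else 0 : ℕ) ≤ 1 := by
  rw [← Finset.sum_filter, ← Finset.card_eq_sum_ones, Finset.card_le_one]
  intro a ha b hb
  simp only [Finset.mem_filter] at ha hb
  by_contra hab
  exact hS a ha.2 b hb.2 (hC ha.1 hb.1 hab)

lemma clique_stable {d : ℕ} (G : SimpleGraph (Fin d)) (C : Finset (Fin d))
    (hC : G.IsClique (C : Set (Fin d))) (S : Set (Fin d)) (hS : IsStableSet G S) :
    ∑ i ∈ C, indicator S i ≤ 1 := by
  classical
  have h := clique_stable_nat G C hC S hS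
  have h' : ((∑ i ∈ C, (if i ∈ S then 1 else 0 : ℕ) : ℕ) : ℝ) ≤ 1 := by exact_mod_cast h
  push_cast at h'
  simpa [indicator, Set.indicator_apply] using h'

open Classical in
/-- Base case: weights at most one. -/
lemma perfect_base {d : ℕ} (G : SimpleGraph (Fin d)) (hG : IsPerfectGraph G)
    (w : Fin d → ℕ) (hw : ∀ i, w i ≤ 1) (M : ℕ)
    (hM : ∀ C : Finset (Fin d), G.IsClique (C : Set (Fin d)) → ∑ i ∈ C, w i ≤ M) :
    ∃ S : Fin M → Set (Fin d), (∀ k, IsStableSet G (S k)) ∧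
      ∀ i, w i = ∑ k, (if i ∈ S k then 1 else 0 : ℕ) := by
  set s : Set (Fin d) := {i | w i = 1} with hs
  have hcn : (G.induce s).chromaticNumber ≤ M := by
    rw [hG s]
    refine iSup₂_le fun t ht => ?_
    have := hM (t.map (Function.Embedding.subtype _)) (by
      intro a ha b hb hab
      simp only [Finset.coe_map, Set.mem_image, Finset.mem_coe] at ha hb
      obtain ⟨a', ha', rfl⟩ := ha
      obtain ⟨b', hb', rfl⟩ := hb
      have hne : a' ≠ b' := fun h => hab (by rw [h])
      exact ht ha' hb' hne)
    rw [Finset.sum_map] at this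
    have h1 : ∀ x ∈ t, w ((Function.Embedding.subtype (· ∈ s)) x) = 1 := fun x _ => x.2
    rw [Finset.sum_congr rfl h1, Finset.sum_const, smul_eq_mul, mul_one] at this
    exact_mod_cast this
  obtain ⟨c⟩ := SimpleGraph.chromaticNumber_le_iff_colorable.mp hcn
  refine ⟨fun k => {i | ∃ h : i ∈ s, c ⟨i, h⟩ = k}, ?_, ?_⟩
  · rintro k i ⟨hi, hik⟩ j ⟨hj, hjk⟩ hadj
    have : (G.induce s).Adj ⟨i, hi⟩ ⟨j, hj⟩ := hadj
    exact c.valid this (hik.trans hjk.symm)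
  · intro i
    by_cases hi : i ∈ s
    · have : w i = 1 := hi
      simp [this, hi]
    · have : w i = 0 := by
        have := hw i
        have h2 : w i ≠ 1 := hi
        omega
      simp [this, hi]

open Classical in
/-- Weighted perfection (Lovász replication). -/
lemma perfect_weighted {d : ℕ} (G : SimpleGraph (Fin d)) (hG : IsPerfectGraph G) (n : ℕ) :
    ∀ (w : Fin d → ℕ), ∑ i, w i = n → ∀ M : ℕ,
    (∀ C : Finset (Fin d), G.IsClique (C : Set (Fin d)) → ∑ i ∈ C, w i ≤ M) →
    ∃ S : Fin M → Set (Fin d), (∀ k, IsStableSet G (S k)) ∧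
      ∀ i, w i = ∑ k, (if i ∈ S k then 1 else 0 : ℕ) := by
  induction n using Nat.strong_induction_on with
  | _ n ih =>
  intro w hwn M hM
  by_cases hw : ∀ i, w i ≤ 1
  · exact perfect_base G hG w hw M hM
  push Not at hw
  obtain ⟨v, hv⟩ := hw
  set w' : Fin d → ℕ := fun i => w i - (if i = v then 1 else 0) with hw'
  have hle : ∀ i, w' i ≤ w i := fun i => Nat.sub_le _ _
  have hlt : ∑ i, w' i < n := by
    rw [← hwn]
    refine Finset.sum_lt_sum (fun i _ => hle i) ⟨v, Finset.mem_univ _, ?_⟩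
    simp [hw']; omega
  obtain ⟨S, hS, hSw⟩ := ih _ hlt w' rfl M
    (fun C hC => (Finset.sum_le_sum fun i _ => hle i).trans (hM C hC))
  have hvk : ∃ k, v ∈ S k := by
    by_contra hcon
    push Not at hcon
    have := hSw v
    simp [hcon, hw'] at this
    omega
  obtain ⟨k, hk⟩ := hvk
  obtain _ | M := M
  · exact k.elim0
  set w2 : Fin d → ℕ := fun i => w i - (if i ∈ S k then 1 else 0) with hw2
  have hw1 : ∀ i, w2 i + (if i ∈ S k then 1 else 0) = w i := by
    intro i
    have h1 := hSw i
    rw [Fin.sum_univ_succAbove _ k] at h1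
    have h2 := hle i
    simp only [hw2]
    omega
  have hlt2 : ∑ i, w2 i < n := by
    rw [← hwn]
    refine Finset.sum_lt_sum (fun i _ => Nat.sub_le _ _) ⟨v, Finset.mem_univ _, ?_⟩
    simp [hw2, hk]; omega
  obtain ⟨T, hT, hTw⟩ := ih _ hlt2 w2 rfl M (by
    intro C hC
    by_cases hvC : v ∈ C
    · have h1 := hM C hC
      have h2 : ∑ i ∈ C, w i = ∑ i ∈ C, w2 i + ∑ i ∈ C, (if i ∈ S k then 1 else 0) := by
        rw [← Finset.sum_add_distrib]
        exact Finset.sum_congr rfl fun i _ => (hw1 i).symm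
      have h3 : 1 ≤ ∑ i ∈ C, (if i ∈ S k then 1 else 0 : ℕ) := by
        have := Finset.single_le_sum (f := fun i => (if i ∈ S k then 1 else 0 : ℕ))
          (fun i _ => Nat.zero_le _) hvC
        simpa [hk] using this
      omega
    · have h1 : ∀ i ∈ C, w2 i = ∑ j : Fin M, (if i ∈ S (k.succAbove j) then 1 else 0 : ℕ) := by
        intro i hi
        have hne : i ≠ v := fun h => hvC (h ▸ hi)
        have h1 := hSw i
        rw [Fin.sum_univ_succAbove _ k] at h1
        have h2 := hw1 i
        simp only [hw', if_neg hne, Nat.sub_zero] at h1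
        omega
      rw [Finset.sum_congr rfl h1, Finset.sum_comm]
      refine (Finset.sum_le_sum fun j _ => clique_stable_nat G C hC _ (hS (k.succAbove j))).trans ?_
      simp)
  refine ⟨Fin.cons (S k) T, ?_, ?_⟩
  · intro j
    refine Fin.cases ?_ (fun j => ?_) j
    · simpa using hS k
    · simpa using hT j
  · intro i
    rw [Fin.sum_univ_succ]
    simp only [Fin.cons_zero, Fin.cons_succ]
    rw [← hTw i, ← hw1 i, add_comm]

lemma lattice_indicator {d : ℕ} (S : Set (Fin d)) : IsLatticePoint (indicator S) := by
  classical
  intro i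
  by_cases h : i ∈ S
  · exact ⟨1, by simp [indicator, h]⟩
  · exact ⟨0, by simp [indicator, h]⟩

lemma ideal_mem {d : ℕ} (P : PartialOrder (Fin d)) (G : SimpleGraph (Fin d)) (I : Set (Fin d))
    (hI : IsPosetIdeal P I) :
    indicator I ∈ gammaPolytope (orderPolytope P) (stableSetPolytope G) :=
  subset_convexHull _ _ (Or.inl (subset_convexHull _ _ ⟨I, hI, rfl⟩))

lemma stable_mem {d : ℕ} (P : PartialOrder (Fin d)) (G : SimpleGraph (Fin d)) (S : Set (Fin d))
    (hS : IsStableSet G S) :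
    -indicator S ∈ gammaPolytope (orderPolytope P) (stableSetPolytope G) :=
  subset_convexHull _ _ (Or.inr (by
    rw [Set.mem_neg, neg_neg]
    exact subset_convexHull _ _ ⟨S, hS, rfl⟩))

/-- Integral decomposition. -/
lemma decomp {d : ℕ} (P : PartialOrder (Fin d)) (G : SimpleGraph (Fin d)) (hG : IsPerfectGraph G)
    (N M : ℕ) (u w : Fin d → ℕ) (hu : ∀ i j, P.le i j → u j ≤ u i) (huN : ∀ i, u i ≤ N)
    (hM : ∀ C : Finset (Fin d), G.IsClique (C : Set (Fin d)) → ∑ i ∈ C, w i ≤ M) :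
    ∃ f : Fin (N + M) → Fin d → ℝ,
      (∀ k, f k ∈ gammaPolytope (orderPolytope P) (stableSetPolytope G) ∧
        IsLatticePoint (f k)) ∧ (fun i => (u i : ℝ) - (w i : ℝ)) = ∑ k, f k := by
  classical
  obtain ⟨S, hS, hSw⟩ := perfect_weighted G hG _ w rfl M hM
  refine ⟨Fin.append (fun k : Fin N => indicator {i | (k : ℕ) < u i})
    (fun k => -indicator (S k)), ?_, ?_⟩
  · intro k
    refine Fin.addCases (fun k => ?_) (fun k => ?_) k
    · rw [Fin.append_left]
      refine ⟨ideal_mem P G _ ?_, lattice_indicator _⟩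
      intro i hi j hj
      exact lt_of_lt_of_le hi (hu j i hj)
    · rw [Fin.append_right]
      refine ⟨stable_mem P G _ (hS k), ?_⟩
      intro i
      obtain ⟨z, hz⟩ := lattice_indicator (S k) i
      exact ⟨-z, by simp [hz]⟩
  · rw [Fin.sum_univ_add]
    funext i
    simp only [Fin.append_left, Fin.append_right, Pi.add_apply, Finset.sum_apply, Pi.neg_apply,
      Finset.sum_neg_distrib]
    rw [← sub_eq_add_neg]
    congr 1
    · have : ∑ k : Fin N, (if (k : ℕ) < u i then 1 else 0 : ℕ) = u i := by
        rw [Fin.sum_univ_eq_sum_range (fun k => if k < u i then 1 else 0) N, ← Finset.sum_filter,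
          ← Finset.card_eq_sum_ones]
        have : (Finset.range N).filter (fun k => k < u i) = Finset.range (u i) := by
          ext k
          have := huN i
          simp only [Finset.mem_filter, Finset.mem_range]
          omega
        rw [this, Finset.card_range]
      have h2 : ((∑ k : Fin N, (if (k : ℕ) < u i then 1 else 0 : ℕ) : ℕ) : ℝ) = u i := by
        rw [this]
      rw [← h2]
      push_cast
      simp [indicator, Set.indicator_apply]
    · rw [hSw i]
      push_cast
      simp [indicator, Set.indicator_apply]

lemma order_props {d : ℕ} (P : PartialOrder (Fin d)) (p : Fin d → ℝ) (hp : p ∈ orderPolytope P) :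
    (∀ i j, P.le i j → p j ≤ p i) ∧ (∀ i, 0 ≤ p i) ∧ ∀ i, p i ≤ 1 := by
  classical
  have hsub : orderPolytope P ⊆
      {p | (∀ i j, P.le i j → p j ≤ p i) ∧ (∀ i, 0 ≤ p i) ∧ ∀ i, p i ≤ 1} := by
    refine convexHull_min ?_ ?_
    · rintro x ⟨I, hI, rfl⟩
      refine ⟨fun i j hij => ?_, fun i => ?_, fun i => ?_⟩
      · simp only [indicator, Set.indicator_apply]
        by_cases hj : j ∈ I
        · simp [hj, hI j hj i hij]
        · simp only [hj, if_false]; split_ifs <;> norm_num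
      · simp only [indicator, Set.indicator_apply]; split_ifs <;> norm_num
      · simp only [indicator, Set.indicator_apply]; split_ifs <;> norm_num
    · rintro x ⟨hx1, hx2, hx3⟩ y ⟨hy1, hy2, hy3⟩ a b ha hb hab
      refine ⟨fun i j hij => ?_, fun i => ?_, fun i => ?_⟩
      · simp only [Pi.add_apply, Pi.smul_apply, smul_eq_mul]
        have := mul_le_mul_of_nonneg_left (hx1 i j hij) ha
        have := mul_le_mul_of_nonneg_left (hy1 i j hij) hb
        linarith
      · simp only [Pi.add_apply, Pi.smul_apply, smul_eq_mul]
        have := mul_nonneg ha (hx2 i)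
        have := mul_nonneg hb (hy2 i)
        linarith
      · simp only [Pi.add_apply, Pi.smul_apply, smul_eq_mul]
        have := mul_le_mul_of_nonneg_left (hx3 i) ha
        have := mul_le_mul_of_nonneg_left (hy3 i) hb
        linarith
  exact hsub hp

lemma stable_props {d : ℕ} (G : SimpleGraph (Fin d)) (q : Fin d → ℝ)
    (hq : q ∈ stableSetPolytope G) :
    (∀ i, 0 ≤ q i) ∧
      ∀ C : Finset (Fin d), G.IsClique (C : Set (Fin d)) → ∑ i ∈ C, q i ≤ 1 := by
  classical
  have hsub : stableSetPolytope G ⊆ {q | (∀ i, 0 ≤ q i) ∧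
      ∀ C : Finset (Fin d), G.IsClique (C : Set (Fin d)) → ∑ i ∈ C, q i ≤ 1} := by
    refine convexHull_min ?_ ?_
    · rintro x ⟨S, hS, rfl⟩
      refine ⟨fun i => ?_, fun C hC => clique_stable G C hC S hS⟩
      simp only [indicator, Set.indicator_apply]; split_ifs <;> norm_num
    · rintro x ⟨hx2, hx3⟩ y ⟨hy2, hy3⟩ a b ha hb hab
      refine ⟨fun i => ?_, fun C hC => ?_⟩
      · simp only [Pi.add_apply, Pi.smul_apply, smul_eq_mul]
        have := mul_nonneg ha (hx2 i)
        have := mul_nonneg hb (hy2 i)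
        linarith
      · simp only [Pi.add_apply, Pi.smul_apply, smul_eq_mul, Finset.sum_add_distrib,
          ← Finset.mul_sum]
        have := mul_le_mul_of_nonneg_left (hx3 C hC) ha
        have := mul_le_mul_of_nonneg_left (hy3 C hC) hb
        linarith
  exact hsub hq

lemma empty_ideal {d : ℕ} (P : PartialOrder (Fin d)) : IsPosetIdeal P ∅ := by
  intro i hi; exact hi.elim

lemma empty_stable {d : ℕ} (G : SimpleGraph (Fin d)) : IsStableSet G ∅ := by
  intro i hi; exact hi.elim

lemma indicator_empty' {d : ℕ} : indicator (∅ : Set (Fin d)) = 0 := by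
  funext i; simp [indicator]

lemma zero_mem_gamma {d : ℕ} (P : PartialOrder (Fin d)) (G : SimpleGraph (Fin d)) :
    0 ∈ gammaPolytope (orderPolytope P) (stableSetPolytope G) := by
  have := ideal_mem P G ∅ (empty_ideal P)
  rwa [indicator_empty'] at this

/-- Rounding down a real decomposition. -/
lemma round_decomp {d : ℕ} (P : PartialOrder (Fin d)) (G : SimpleGraph (Fin d))
    (hG : IsPerfectGraph G) (m : ℕ) (l : ℝ) (hl0 : 0 ≤ l) (hlm : l ≤ m) (u w : Fin d → ℝ)
    (hu : ∀ i j, P.le i j → u j ≤ u i) (hul : ∀ i, u i ≤ l)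
    (hw0 : ∀ i, 0 ≤ w i)
    (hM : ∀ C : Finset (Fin d), G.IsClique (C : Set (Fin d)) → ∑ i ∈ C, w i ≤ m - l) :
    ∃ f : Fin m → Fin d → ℝ,
      (∀ k, f k ∈ gammaPolytope (orderPolytope P) (stableSetPolytope G) ∧
        IsLatticePoint (f k)) ∧ (fun i => (⌊u i⌋₊ : ℝ) - (⌊w i⌋₊ : ℝ)) = ∑ k, f k := by
  have hN : ⌊l⌋₊ ≤ m := Nat.floor_le_of_le hlm
  have hNl : (⌊l⌋₊ : ℝ) ≤ l := Nat.floor_le hl0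
  obtain ⟨M, rfl⟩ := Nat.exists_eq_add_of_le hN
  refine decomp P G hG _ M (fun i => ⌊u i⌋₊) (fun i => ⌊w i⌋₊)
    (fun i j hij => Nat.floor_le_floor (hu i j hij)) (fun i => Nat.floor_le_floor (hul i)) ?_
  intro C hC
  have h1 := hM C hC
  have h2 : ∑ i ∈ C, (⌊w i⌋₊ : ℝ) ≤ ∑ i ∈ C, w i :=
    Finset.sum_le_sum fun i _ => Nat.floor_le (hw0 i)
  have h3 : ((∑ i ∈ C, ⌊w i⌋₊ : ℕ) : ℝ) < ((M + 1 : ℕ) : ℝ) := by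
    have h4 : l < ⌊l⌋₊ + 1 := Nat.lt_floor_add_one l
    push_cast at h1 ⊢
    linarith
  have := Nat.cast_lt.mp h3
  omega

lemma idp_part {d : ℕ} (P : PartialOrder (Fin d)) (G : SimpleGraph (Fin d))
    (hG : IsPerfectGraph G) :
    HasIDP (gammaPolytope (orderPolytope P) (stableSetPolytope G)) := by
  intro m hm a ha hmem
  obtain ⟨g, hg, rfl⟩ := hmem
  have hO : (orderPolytope P).Nonempty := ⟨_, subset_convexHull _ _ ⟨∅, empty_ideal P, rfl⟩⟩
  have hQ : (-stableSetPolytope G).Nonempty :=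
    Set.Nonempty.neg ⟨_, subset_convexHull _ _ ⟨∅, empty_stable G, rfl⟩⟩
  have hcO : Convex ℝ (orderPolytope P) := convex_convexHull _ _
  have hcQ : Convex ℝ (-stableSetPolytope G) := (convex_convexHull _ _).neg
  rw [gammaPolytope, hcO.convexHull_union hcQ hO hQ, mem_convexJoin] at hg
  obtain ⟨p, hp, q, hq, s, t, hs, ht, hst, rfl⟩ := hg
  obtain ⟨hp1, hp2, hp3⟩ := order_props P p hp
  obtain ⟨hq1, hq2⟩ := stable_props G (-q) hq
  have hm0 : (0 : ℝ) ≤ m := Nat.cast_nonneg m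
  have hms : 0 ≤ (m : ℝ) * s := mul_nonneg hm0 hs
  have hmt : 0 ≤ (m : ℝ) * t := mul_nonneg hm0 ht
  obtain ⟨f, hf, hsum⟩ := round_decomp P G hG m (m * s) hms
    (by nlinarith) (fun i => m * s * p i) (fun i => m * t * (-q) i)
    (fun i j hij => mul_le_mul_of_nonneg_left (hp1 i j hij) hms)
    (fun i => by have := mul_le_mul_of_nonneg_left (hp3 i) hms; linarith)
    (fun i => mul_nonneg hmt (hq1 i))
    (fun C hC => by
      rw [← Finset.mul_sum]
      have := mul_le_mul_of_nonneg_left (hq2 C hC) hmt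
      have h2 : (m : ℝ) = m * s + m * t := by rw [← mul_add, hst, mul_one]
      linarith)
  refine ⟨f, hf, ?_⟩
  rw [← hsum]
  funext i
  obtain ⟨z, hz⟩ := ha i
  have hz' : (m : ℝ) * s * p i = z + m * t * (-q) i := by
    simp only [Pi.smul_apply, Pi.add_apply, smul_eq_mul, Pi.neg_apply] at hz ⊢
    linarith
  have hA : 0 ≤ (m : ℝ) * s * p i := mul_nonneg hms (hp2 i)
  have hB : 0 ≤ (m : ℝ) * t * (-q) i := mul_nonneg hmt (hq1 i)
  simp only [hz]
  rw [natCast_floor_eq_intCast_floor hA, natCast_floor_eq_intCast_floor hB, hz',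
    Int.floor_intCast_add]
  push_cast
  ring

/-- Unit vector or zero. -/
noncomputable def ev {d : ℕ} (o : Option (Fin d)) : Fin d → ℝ :=
  o.elim 0 (fun j => Pi.single j 1)

/-- Coordinate of `y`, or zero. -/
def val {d : ℕ} (y : Fin d → ℝ) (o : Option (Fin d)) : ℝ := o.elim 0 y

/-- The candidate facet normals. -/
noncomputable def vec {d : ℕ} (j : Option (Fin d)) (C : Finset (Fin d))
    (f : Fin d → Option (Fin d)) : Fin d → ℝ :=
  ev j + ∑ i ∈ C, (ev (f i) - Pi.single i 1)

lemma ev_dot {d : ℕ} (o : Option (Fin d)) (y : Fin d → ℝ) : ev o ⬝ᵥ y = val y o := by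
  cases o <;> simp [ev, val]

lemma vec_dot {d : ℕ} (j : Option (Fin d)) (C : Finset (Fin d))
    (f : Fin d → Option (Fin d)) (y : Fin d → ℝ) :
    vec j C f ⬝ᵥ y = val y j + ∑ i ∈ C, (val y (f i) - y i) := by
  simp only [vec, add_dotProduct, sum_dotProduct, sub_dotProduct, ev_dot, single_one_dotProduct]

lemma ev_lattice {d : ℕ} (o : Option (Fin d)) (i : Fin d) : ∃ z : ℤ, ev o i = z := by
  cases o with
  | none => exact ⟨0, by simp [ev]⟩
  | some j =>
    by_cases h : i = j
    · subst h; exact ⟨1, by simp [ev]⟩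
    · exact ⟨0, by simp [ev, h]⟩

lemma vec_lattice {d : ℕ} (j : Option (Fin d)) (C : Finset (Fin d))
    (f : Fin d → Option (Fin d)) : IsLatticePoint (vec j C f) := by
  intro i
  obtain ⟨z, hz⟩ := ev_lattice j i
  choose g hg using fun k => ev_lattice (f k) i
  choose h hh using fun k => ev_lattice (some k : Option (Fin d)) i
  refine ⟨z + ∑ k ∈ C, (g k - h k), ?_⟩
  have hh' : ∀ k, (Pi.single k (1 : ℝ) : Fin d → ℝ) i = h k := hh
  simp [vec, hz, hg, hh']

/-- The set of candidate facet normals. -/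
def vset {d : ℕ} (P : PartialOrder (Fin d)) (G : SimpleGraph (Fin d)) : Set (Fin d → ℝ) :=
  {x | ∃ (j : Option (Fin d)) (C : Finset (Fin d)) (f : Fin d → Option (Fin d)),
    G.IsClique (C : Set (Fin d)) ∧ (∀ i, ∀ k, f i = some k → P.le i k) ∧
    x = vec j C f}

lemma vset_finite {d : ℕ} (P : PartialOrder (Fin d)) (G : SimpleGraph (Fin d)) :
    (vset P G).Finite := by
  refine (Set.finite_range (fun t : Option (Fin d) × Finset (Fin d) × (Fin d → Option (Fin d)) =>
    vec t.1 t.2.1 t.2.2)).subset ?_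
  rintro x ⟨j, C, f, -, -, rfl⟩
  exact ⟨(j, C, f), rfl⟩

lemma val_nonneg_le {d : ℕ} (S : Set (Fin d)) (o : Option (Fin d)) :
    0 ≤ val (indicator S) o ∧ val (indicator S) o ≤ 1 := by
  classical
  cases o with
  | none => simp [val]
  | some j => simp only [val, indicator, Option.elim, Set.indicator_apply]; split_ifs <;> norm_num

lemma vset_sub_dual {d : ℕ} (P : PartialOrder (Fin d)) (G : SimpleGraph (Fin d)) :
    vset P G ⊆ dualPolytope (gammaPolytope (orderPolytope P) (stableSetPolytope G)) := by
  classical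
  rintro x ⟨j, C, f, hC, hf, rfl⟩ y hy
  have hhalf : Convex ℝ {y : Fin d → ℝ | vec j C f ⬝ᵥ y ≤ 1} := by
    intro a ha b hb s t hs ht hst
    simp only [Set.mem_ofPred_eq] at *
    rw [dotProduct_add, dotProduct_smul, dotProduct_smul, smul_eq_mul, smul_eq_mul]
    nlinarith
  have hsub : gammaPolytope (orderPolytope P) (stableSetPolytope G) ⊆
      {y : Fin d → ℝ | vec j C f ⬝ᵥ y ≤ 1} := by
    refine convexHull_min (Set.union_subset ?_ ?_) hhalf
    · refine convexHull_min ?_ hhalf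
      rintro _ ⟨I, hI, rfl⟩
      simp only [Set.mem_ofPred_eq, vec_dot]
      have h1 := (val_nonneg_le I j).2
      have h2 : ∑ i ∈ C, (val (indicator I) (f i) - indicator I i) ≤ 0 := by
        refine Finset.sum_nonpos fun i _ => ?_
        cases hfi : f i with
        | none =>
          have := (val_nonneg_le I (some i)).1
          simp only [val, Option.elim] at this ⊢
          linarith
        | some k =>
          have hik := hf i k hfi
          simp only [val, Option.elim, indicator, Set.indicator_apply]
          by_cases hk : k ∈ I
          · simp [hk, hI k hk i hik]
          · simp only [hk, if_false]; split_ifs <;> norm_num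
      linarith
    · have hhalf2 : Convex ℝ (-{y : Fin d → ℝ | vec j C f ⬝ᵥ y ≤ 1}) := hhalf.neg
      rw [← Set.neg_subset_neg, neg_neg]
      refine convexHull_min ?_ hhalf2
      rintro _ ⟨S, hS, rfl⟩
      rw [Set.mem_neg, Set.mem_ofPred_eq, dotProduct_neg, vec_dot]
      have h1 := (val_nonneg_le S j).1
      have h2 := clique_stable G C hC S hS
      have h3 : 0 ≤ ∑ i ∈ C, val (indicator S) (f i) :=
        Finset.sum_nonneg fun i _ => (val_nonneg_le S _).1
      rw [Finset.sum_sub_distrib]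
      linarith
  exact hsub hy

/-- Points satisfying all candidate inequalities satisfy every valid inequality of `Γ`. -/
lemma key {d : ℕ} (P : PartialOrder (Fin d)) (G : SimpleGraph (Fin d)) (hG : IsPerfectGraph G)
    (y : Fin d → ℝ) (hy : ∀ v ∈ vset P G, v ⬝ᵥ y ≤ 1) (x : Fin d → ℝ)
    (hx : x ∈ dualPolytope (gammaPolytope (orderPolytope P) (stableSetPolytope G))) :
    x ⬝ᵥ y ≤ 1 := by
  have hex : ∀ i, ∃ o : Option (Fin d), (∀ k, o = some k → P.le i k) ∧
      ∀ o' : Option (Fin d), (∀ k, o' = some k → P.le i k) → val y o' ≤ val y o := by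
    intro i
    obtain ⟨o, ho, hmax⟩ := Set.exists_max_image
      {o : Option (Fin d) | ∀ k, o = some k → P.le i k} (val y) (Set.toFinite _)
      ⟨none, by simp⟩
    exact ⟨o, ho, hmax⟩
  choose f hf hfmax using hex
  obtain ⟨j, hj⟩ := Finite.exists_max (val y)
  set u : Fin d → ℝ := fun i => val y (f i) with hu
  set l := val y j with hl
  have hl0 : 0 ≤ l := hj none
  have hu0 : ∀ i, 0 ≤ u i := fun i => hfmax i none (by simp)
  have huy : ∀ i, y i ≤ u i := fun i => hfmax i (some i) (by
    intro k hk
    cases hk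
    exact P.le_refl i)
  have hanti : ∀ i k, P.le i k → u k ≤ u i := fun i k hik =>
    hfmax i (f k) (fun r hr => P.le_trans i k r hik (hf k r hr))
  have hC : ∀ C : Finset (Fin d), G.IsClique (C : Set (Fin d)) →
      l + ∑ i ∈ C, (u i - y i) ≤ 1 := by
    intro C hC
    have := hy _ ⟨j, C, f, hC, hf, rfl⟩
    rwa [vec_dot] at this
  have hl1 : l ≤ 1 := by simpa using hC ∅ (by simp)
  -- finite level inequality
  have hn : ∀ n : ℕ, 0 < n →
      ∑ i, x i * ((⌊u i * n⌋₊ : ℝ) / n - (⌊(u i - y i) * n⌋₊ : ℝ) / n) ≤ 1 := by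
    intro n hn
    have hn0 : (0 : ℝ) < n := Nat.cast_pos.mpr hn
    obtain ⟨g, hg, hsum⟩ := round_decomp P G hG n (l * n) (by positivity) (by nlinarith)
      (fun i => u i * n) (fun i => (u i - y i) * n)
      (fun i k hik => mul_le_mul_of_nonneg_right (hanti i k hik) hn0.le)
      (fun i => mul_le_mul_of_nonneg_right (hj (f i)) hn0.le)
      (fun i => mul_nonneg (sub_nonneg.mpr (huy i)) hn0.le)
      (fun C hCc => by
        rw [← Finset.sum_mul]
        have := mul_le_mul_of_nonneg_right (hC C hCc) hn0.le
        linarith)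
    have h1 : x ⬝ᵥ (∑ k, g k) ≤ n := by
      rw [dotProduct_sum]
      refine (Finset.sum_le_sum fun k _ => hx (g k) (hg k).1).trans ?_
      simp
    rw [← hsum] at h1
    have h2 : ∑ i, x i * ((⌊u i * n⌋₊ : ℝ) / n - (⌊(u i - y i) * n⌋₊ : ℝ) / n) =
        (∑ i, x i * ((⌊u i * n⌋₊ : ℝ) - (⌊(u i - y i) * n⌋₊ : ℝ))) / n := by
      rw [Finset.sum_div]
      refine Finset.sum_congr rfl fun i _ => ?_
      ring
    rw [h2, div_le_one hn0]
    exact h1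
  have hlim : Filter.Tendsto (fun n : ℕ =>
      ∑ i, x i * ((⌊u i * n⌋₊ : ℝ) / n - (⌊(u i - y i) * n⌋₊ : ℝ) / n)) Filter.atTop
      (nhds (∑ i, x i * (u i - (u i - y i)))) := by
    refine tendsto_finsetSum _ fun i _ => Filter.Tendsto.const_mul _ (Filter.Tendsto.sub ?_ ?_)
    · exact (tendsto_nat_floor_mul_div_atTop (hu0 i)).comp tendsto_natCast_atTop_atTop
    · exact (tendsto_nat_floor_mul_div_atTop (sub_nonneg.mpr (huy i))).comp
        tendsto_natCast_atTop_atTop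
  have := le_of_tendsto hlim (Filter.eventually_atTop.mpr ⟨1, fun n h => hn n h⟩)
  simpa [dotProduct] using this

lemma dual_eq {d : ℕ} (P : PartialOrder (Fin d)) (G : SimpleGraph (Fin d))
    (hG : IsPerfectGraph G) :
    dualPolytope (gammaPolytope (orderPolytope P) (stableSetPolytope G)) =
      convexHull ℝ (vset P G) := by
  apply Set.Subset.antisymm
  · intro x hx
    by_contra hnot
    obtain ⟨φ, c, hφ, hc⟩ := geometric_hahn_banach_closed_point (convex_convexHull ℝ (vset P G))
      ((vset_finite P G).isClosed_convexHull (𝕜 := ℝ)) hnot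
    have h0 : (0 : Fin d → ℝ) ∈ vset P G :=
      ⟨none, ∅, fun _ => none, by simp, by simp, by simp [vec, ev]⟩
    have hc0 : 0 < c := by simpa using hφ 0 (subset_convexHull _ _ h0)
    have hrep : ∀ z : Fin d → ℝ, φ z = z ⬝ᵥ (fun i => φ (Pi.single i 1)) := by
      intro z
      conv_lhs => rw [pi_eq_sum_univ' z]
      simp [dotProduct, map_sum]
    have hk := key P G hG (c⁻¹ • fun i => φ (Pi.single i 1)) (by
      intro v hv
      rw [dotProduct_smul, ← hrep, smul_eq_mul, inv_mul_le_iff₀ hc0, mul_one]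
      exact (hφ v (subset_convexHull _ _ hv)).le) x hx
    rw [dotProduct_smul, ← hrep, smul_eq_mul, inv_mul_le_iff₀ hc0, mul_one] at hk
    linarith
  · refine convexHull_min (vset_sub_dual P G) ?_
    intro a ha b hb s t hs ht hst y hy
    have h1 : a ⬝ᵥ y ≤ 1 := ha y hy
    have h2 : b ⬝ᵥ y ≤ 1 := hb y hy
    change (s • a + t • b) ⬝ᵥ y ≤ 1
    rw [add_dotProduct, smul_dotProduct, smul_dotProduct, smul_eq_mul, smul_eq_mul]
    nlinarith

lemma zero_interior {d : ℕ} (P : PartialOrder (Fin d)) (G : SimpleGraph (Fin d)) :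
    (0 : Fin d → ℝ) ∈ interior (gammaPolytope (orderPolytope P) (stableSetPolytope G)) := by
  classical
  rw [mem_interior_iff_mem_nhds, Metric.mem_nhds_iff]
  set ε : ℝ := 1 / (1 + 2 * d) with hε
  have hd0 : (0 : ℝ) ≤ d := Nat.cast_nonneg d
  have hεpos : 0 < ε := by positivity
  refine ⟨ε, hεpos, ?_⟩
  intro a ha
  have hai : ∀ i, |a i| < ε := by
    intro i
    have := (norm_le_pi_norm a i).trans_lt (mem_ball_zero_iff.mp ha)
    simpa using this
  have hconv : Convex ℝ (gammaPolytope (orderPolytope P) (stableSetPolytope G)) :=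
    convex_convexHull _ _
  have htot : ε + ∑ i, (ε - a i) ≤ 1 := by
    have h1 : ∑ i, (ε - a i) ≤ ∑ i : Fin d, 2 * ε :=
      Finset.sum_le_sum fun i _ => by have := (abs_lt.mp (hai i)).1; linarith
    have h2 : ε * (1 + 2 * d) = 1 := by rw [hε]; field_simp
    simp at h1
    simp
    linarith
  have hsing : ∀ i, IsStableSet G {i} := by
    intro i a ha b hb
    rw [Set.mem_singleton_iff] at ha hb
    subst ha; subst hb
    exact G.irrefl
  have hmem := hconv.sum_mem (t := (Finset.univ : Finset (Option (Option (Fin d)))))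
    (w := fun o => o.elim (1 - (ε + ∑ i, (ε - a i))) (fun o => o.elim ε (fun i => ε - a i)))
    (z := fun o => o.elim 0 (fun o => o.elim (indicator Set.univ) (fun i => -indicator {i})))
    (by
      rintro (_ | _ | i) -
      · simp only [Option.elim]; linarith
      · exact hεpos.le
      · have := (abs_lt.mp (hai i)).2
        simp only [Option.elim]; linarith)
    (by simp [Fintype.sum_option])
    (by
      rintro (_ | _ | i) -
      · exact zero_mem_gamma P G
      · exact ideal_mem P G _ (fun _ _ _ _ => trivial)
      · exact stable_mem P G _ (hsing i))
  convert hmem using 1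
  funext k
  simp [Fintype.sum_option, indicator, Finset.sum_apply, Pi.single_apply]

/-- For every poset `P` on `[d]` and every perfect graph `G` on `[d]` (`d ≥ 1`),
`Γ(O_P, Q_G)` is a reflexive polytope with the integer decomposition property. -/
theorem gamma_reflexive_and_idp (d : ℕ) (hd : 1 ≤ d) (P : PartialOrder (Fin d))
    (G : SimpleGraph (Fin d)) (hG : IsPerfectGraph G) :
    IsReflexive (gammaPolytope (orderPolytope P) (stableSetPolytope G)) ∧
      HasIDP (gammaPolytope (orderPolytope P) (stableSetPolytope G)) := by
  refine ⟨⟨zero_interior P G, (vset_finite P G).toFinset, ?_, ?_⟩, idp_part P G hG⟩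
  · intro v hv
    obtain ⟨j, C, f, -, -, rfl⟩ := (vset_finite P G).mem_toFinset.mp hv
    exact vec_lattice j C f
  · rw [Set.Finite.coe_toFinset]
    exact dual_eq P G hG

end HibiTsuchiya
end

section
/- Let d ≥ 1, let P be a finite partially ordered set on [d] = {1,...,d}, and let G be a perfect graph on [d]. Then the Ehrhart δ-polynomials satisfy δ(Γ(O_P, Q_G), λ) = δ(Γ(C_P, Q_G), λ). -/
open scoped Pointwise

namespace HibiTsuchiya

/-- The number of lattice points of a set `P ⊆ ℝ^n`. -/
noncomputable def latticePointCount {n : ℕ} (P : Set (Fin n → ℝ)) : ℕ :=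
  Set.ncard {x | x ∈ P ∧ IsLatticePoint x}

/-- The Ehrhart series `1 + ∑_{m ≥ 1} |mP ∩ ℤ^n| λ^m` of `P ⊆ ℝ^n`. -/
noncomputable def ehrhartSeries {n : ℕ} (P : Set (Fin n → ℝ)) : PowerSeries ℚ :=
  PowerSeries.mk fun m => if m = 0 then 1 else (latticePointCount ((m : ℝ) • P) : ℚ)

/-- The Ehrhart `δ`-polynomial `δ(P,λ) = (1-λ)^{n+1} (1 + ∑_{m ≥ 1} |mP ∩ ℤ^n| λ^m)`
of a polytope `P ⊆ ℝ^n`, encoded as a formal power series. -/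
noncomputable def deltaPolynomial {n : ℕ} (P : Set (Fin n → ℝ)) : PowerSeries ℚ :=
  (1 - PowerSeries.X) ^ (n + 1) * ehrhartSeries P

/-! ### Helper lemmas -/

open MeasureTheory in
/-- Layer-cake averaging: a closed convex set containing all layers contains their average. -/
lemma layer_mem {n : ℕ} {K : Set (Fin n → ℝ)} (hc : Convex ℝ K) (hcl : IsClosed K)
    (l u c : Fin n → ℝ) (hl : ∀ i, 0 ≤ l i) (hlu : ∀ i, l i ≤ u i) (hu : ∀ i, u i ≤ 1)
    (h : ∀ θ : ℝ, 0 < θ → θ ≤ 1 →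
      (fun i => (Set.Ioc (l i) (u i)).indicator (fun _ => c i) θ) ∈ K) :
    (fun i => (u i - l i) * c i) ∈ K := by
  let μ : Measure ℝ := volume.restrict (Set.Ioc 0 1)
  haveI : IsProbabilityMeasure μ := ⟨by simp [μ]⟩
  let f : ℝ → Fin n → ℝ := fun θ i => (Set.Ioc (l i) (u i)).indicator (fun _ => c i) θ
  have hint : ∀ i, Integrable (fun θ => f θ i) μ := by
    intro i
    exact (integrable_const (c i)).indicator measurableSet_Ioc
  have hf : Integrable f μ := Integrable.of_eval hint
  have hmem : ∫ θ, f θ ∂μ ∈ K := by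
    refine hc.integral_mem hcl ?_ hf
    refine (ae_restrict_iff' measurableSet_Ioc).2 (Filter.Eventually.of_forall ?_)
    intro θ hθ
    exact h θ hθ.1 hθ.2
  convert hmem using 1
  funext i
  rw [eval_integral hint]
  have : ∫ θ, f θ i ∂μ = ∫ θ in Set.Ioc (l i) (u i), c i ∂μ :=
    integral_indicator measurableSet_Ioc
  rw [this]
  have hsub : Set.Ioc (l i) (u i) ⊆ Set.Ioc 0 1 := Set.Ioc_subset_Ioc (hl i) (hu i)
  rw [setIntegral_const]
  have : μ.real (Set.Ioc (l i) (u i)) = u i - l i := by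
    simp only [μ]
    rw [measureReal_restrict_apply measurableSet_Ioc, Set.inter_eq_left.2 hsub]
    simp [Measure.real, hlu i]
  rw [this, smul_eq_mul]

/-- The convex hull of the indicators of a family of sets. -/
def hullOf {n : ℕ} (p : Set (Fin n) → Prop) : Set (Fin n → ℝ) :=
  convexHull ℝ {x | ∃ S : Set (Fin n), p S ∧ x = indicator S}

lemma hullOf_closed {n : ℕ} (p : Set (Fin n) → Prop) : IsClosed (hullOf p) := by
  have hfin : Set.Finite {x : Fin n → ℝ | ∃ S : Set (Fin n), p S ∧ x = indicator S} := by
    refine (Set.finite_range (fun S : Set (Fin n) => indicator S)).subset ?_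
    rintro x ⟨S, -, rfl⟩
    exact ⟨S, rfl⟩
  exact hfin.isClosed_convexHull ℝ

lemma hullOf_convex {n : ℕ} (p : Set (Fin n) → Prop) : Convex ℝ (hullOf p) :=
  convex_convexHull ℝ _

lemma hullOf_zero {n : ℕ} (p : Set (Fin n) → Prop) (h : p ∅) : (0 : Fin n → ℝ) ∈ hullOf p :=
  subset_convexHull ℝ _ ⟨∅, h, by ext; simp [indicator]⟩

lemma hullOf_nonneg {n : ℕ} (p : Set (Fin n) → Prop) {x : Fin n → ℝ} (hx : x ∈ hullOf p) :
    ∀ i, 0 ≤ x i := by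
  have : hullOf p ⊆ {x | ∀ i, 0 ≤ x i} := by
    refine convexHull_min ?_ ?_
    · rintro x ⟨S, -, rfl⟩ i
      exact Set.indicator_nonneg (fun _ _ => zero_le_one) _
    · intro x hx y hy a b ha hb _ i
      have h1 := mul_nonneg ha (hx i)
      have h2 := mul_nonneg hb (hy i)
      simp only [Pi.add_apply, Pi.smul_apply, smul_eq_mul]
      linarith
  exact this hx

lemma layer_hull {n : ℕ} (p : Set (Fin n) → Prop) (l u : Fin n → ℝ)
    (hl : ∀ i, 0 ≤ l i) (hlu : ∀ i, l i ≤ u i) (hu : ∀ i, u i ≤ 1)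
    (h : ∀ θ : ℝ, 0 < θ → θ ≤ 1 → p {i | l i < θ ∧ θ ≤ u i}) :
    (fun i => u i - l i) ∈ hullOf p := by
  have := layer_mem (hullOf_convex p) (hullOf_closed p) l u (fun _ => 1) hl hlu hu
    (fun θ h0 h1 => subset_convexHull ℝ _ ⟨_, h θ h0 h1, by
      funext i
      simp [indicator, Set.indicator]⟩)
  simpa using this

/-- Anti-blocking property. -/
lemma hullOf_down {n : ℕ} (p : Set (Fin n) → Prop) (hp : ∀ S T, S ⊆ T → p T → p S)
    {q q' : Fin n → ℝ} (hq : q ∈ hullOf p) (h0 : ∀ i, 0 ≤ q' i) (h1 : ∀ i, q' i ≤ q i) :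
    q' ∈ hullOf p := by
  classical
  have hmask : ∀ T : Set (Fin n), (fun i => T.indicator (fun i => q i) i) ∈ hullOf p := by
    intro T
    let L : (Fin n → ℝ) →ₗ[ℝ] (Fin n → ℝ) :=
      { toFun := fun x => T.indicator x
        map_add' := fun x y => Set.indicator_add _ _ _
        map_smul' := fun c x => by
          funext i
          by_cases hi : i ∈ T <;> simp [hi] }
    have hL : L q ∈ L '' hullOf p := ⟨q, hq, rfl⟩
    rw [hullOf, L.image_convexHull] at hL
    refine convexHull_mono ?_ hL
    rintro _ ⟨_, ⟨S, hS, rfl⟩, rfl⟩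
    refine ⟨T ∩ S, hp _ _ Set.inter_subset_right hS, ?_⟩
    simp only [L, indicator, LinearMap.coe_mk, AddHom.coe_mk]
    rw [Set.indicator_indicator]
  have hq0 := hullOf_nonneg p hq
  have := layer_mem (hullOf_convex p) (hullOf_closed p) (fun _ => 0) (fun i => q' i / q i) q
    (fun _ => le_rfl) (fun i => div_nonneg (h0 i) (hq0 i))
    (fun i => div_le_one_of_le₀ (h1 i) (hq0 i))
    (fun θ hθ _ => by
      convert hmask {i | θ ≤ q' i / q i} using 1
      funext i
      simp [Set.indicator, hθ])
  convert this using 1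
  funext i
  rcases (hq0 i).eq_or_lt with h | h
  · have a := h0 i
    have b := h1 i
    rw [← h] at b ⊢
    simp; linarith
  · field_simp; simp

lemma mem_gamma {n : ℕ} {K Q : Set (Fin n → ℝ)} (hK : Convex ℝ K) (hQ : Convex ℝ Q)
    (hK0 : 0 ∈ K) (hQ0 : 0 ∈ Q) (x : Fin n → ℝ) :
    x ∈ gammaPolytope K Q ↔ ∃ s t : ℝ, 0 ≤ s ∧ 0 ≤ t ∧ s + t = 1 ∧
      ∃ c ∈ K, ∃ q ∈ Q, x = s • c - t • q := by
  rw [gammaPolytope, convexHull_union ⟨0, hK0⟩ ⟨0, by simpa using hQ0⟩, hK.convexHull_eq,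
    hQ.neg.convexHull_eq, mem_convexJoin]
  constructor
  · rintro ⟨c, hc, q, hq, s, t, hs, ht, hst, rfl⟩
    exact ⟨s, t, hs, ht, hst, c, hc, -q, hq, by simp⟩
  · rintro ⟨s, t, hs, ht, hst, c, hc, q, hq, rfl⟩
    exact ⟨c, hc, -q, by simpa using hq, s, t, hs, ht, hst, by simp [sub_eq_add_neg]⟩

section Transfer

variable {n : ℕ} (r : Fin n → Fin n → Prop)

open Classical in
/-- `upMax r x i` is the maximum of `0` and all `x j` with `r i j`. -/
noncomputable def upMax (x : Fin n → ℝ) (i : Fin n) : ℝ :=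
  Finset.univ.sup' ⟨i, Finset.mem_univ i⟩ (fun j => if r i j then max (x j) 0 else 0)

lemma le_upMax (x : Fin n → ℝ) {i j : Fin n} (h : r i j) : max (x j) 0 ≤ upMax r x i := by
  classical
  have := Finset.le_sup' (fun j => if r i j then max (x j) 0 else 0) (Finset.mem_univ j)
  simpa [upMax, h] using this

lemma upMax_cases (x : Fin n → ℝ) (i : Fin n) :
    upMax r x i = 0 ∨ ∃ j, r i j ∧ upMax r x i = max (x j) 0 := by
  classical
  obtain ⟨j, -, hj⟩ := Finset.exists_mem_eq_sup' (s := Finset.univ) ⟨i, Finset.mem_univ i⟩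
    (fun j => if r i j then max (x j) 0 else 0)
  by_cases h : r i j
  · right; exact ⟨j, h, by rw [upMax, hj, if_pos h]⟩
  · left; rw [upMax, hj, if_neg h]

lemma upMax_nonneg (x : Fin n → ℝ) (i : Fin n) : 0 ≤ upMax r x i := by
  rcases upMax_cases r x i with h | ⟨j, -, h⟩
  · exact h.ge
  · rw [h]; exact le_max_right _ _

lemma upMax_congr {x y : Fin n → ℝ} {i : Fin n} (h : ∀ j, r i j → x j = y j) :
    upMax r x i = upMax r y i := by
  classical
  unfold upMax
  congr 1
  funext j
  by_cases hj : r i j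
  · simp [hj, h j hj]
  · simp [hj]

/-- The piecewise linear transfer map. -/
noncomputable def psi (x : Fin n → ℝ) : Fin n → ℝ := fun i => x i - upMax r x i

lemma upMax_smul {c : ℝ} (hc : 0 ≤ c) (x : Fin n → ℝ) (i : Fin n) :
    upMax r (c • x) i = c * upMax r x i := by
  have hmax : ∀ j, max ((c • x) j) 0 = c * max (x j) 0 := by
    intro j
    simp [mul_max_of_nonneg _ _ hc]
  apply le_antisymm
  · rcases upMax_cases r (c • x) i with h | ⟨j, hj, h⟩
    · rw [h]; exact mul_nonneg hc (upMax_nonneg r x i)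
    · rw [h, hmax]; exact mul_le_mul_of_nonneg_left (le_upMax r x hj) hc
  · rcases upMax_cases r x i with h | ⟨j, hj, h⟩
    · rw [h, mul_zero]; exact upMax_nonneg r _ i
    · rw [h, ← hmax]; exact le_upMax r _ hj

lemma psi_smul {c : ℝ} (hc : 0 ≤ c) (x : Fin n → ℝ) : psi r (c • x) = c • psi r x := by
  funext i
  simp [psi, upMax_smul r hc, mul_sub]

lemma wf_flip (hirr : ∀ i, ¬ r i i) (htr : ∀ i j k, r i j → r j k → r i k) :
    WellFounded (fun j i => r i j) := by
  haveI : IsTrans (Fin n) (fun j i => r i j) := ⟨fun a b c h1 h2 => htr c b a h2 h1⟩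
  haveI : Std.Irrefl (fun j i : Fin n => r i j) := ⟨hirr⟩
  exact Finite.wellFounded_of_trans_of_irrefl _

lemma psi_injective (hirr : ∀ i, ¬ r i i) (htr : ∀ i j k, r i j → r j k → r i k) :
    Function.Injective (psi r) := by
  intro x y h
  funext i
  induction i using (wf_flip r hirr htr).induction with
  | _ i ih =>
    have h1 := congrFun h i
    have h2 := upMax_congr r ih
    simp only [psi] at h1
    linarith

lemma psi_surjective (hirr : ∀ i, ¬ r i i) (htr : ∀ i j k, r i j → r j k → r i k) :
    Function.Surjective (psi r) := by
  classical
  intro z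
  let wf := wf_flip r hirr htr
  let F : (i : Fin n) → ((j : Fin n) → r i j → ℝ) → ℝ := fun i rec =>
    z i + Finset.univ.sup' ⟨i, Finset.mem_univ i⟩
      (fun j => if h : r i j then max (rec j h) 0 else 0)
  let x : Fin n → ℝ := wf.fix F
  refine ⟨x, ?_⟩
  funext i
  have hx : x i = F i (fun j _ => x j) := wf.fix_eq F i
  have : x i = z i + upMax r x i := by
    rw [hx]
    simp only [F, upMax, dite_eq_ite]
  simp only [psi]
  linarith

lemma upMax_lattice {x : Fin n → ℝ} {i : Fin n} (h : ∀ j, r i j → ∃ z : ℤ, x j = z) :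
    ∃ z : ℤ, upMax r x i = z := by
  rcases upMax_cases r x i with h0 | ⟨j, hj, h0⟩
  · exact ⟨0, by simpa using h0⟩
  · obtain ⟨z, hz⟩ := h j hj
    exact ⟨max z 0, by rw [h0, hz]; push_cast; rfl⟩

lemma psi_lattice (hirr : ∀ i, ¬ r i i) (htr : ∀ i j k, r i j → r j k → r i k)
    (x : Fin n → ℝ) : IsLatticePoint (psi r x) ↔ IsLatticePoint x := by
  constructor
  · intro h i
    induction i using (wf_flip r hirr htr).induction with
    | _ i ih =>
      obtain ⟨a, ha⟩ := h i
      obtain ⟨b, hb⟩ := upMax_lattice r ih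
      refine ⟨a + b, ?_⟩
      simp only [psi] at ha
      push_cast
      linarith
  · intro h i
    obtain ⟨a, ha⟩ := h i
    obtain ⟨b, hb⟩ := upMax_lattice r (x := x) (i := i) (fun j _ => h j)
    exact ⟨a - b, by simp [psi, ha, hb]⟩

lemma upMax_anti (hirr : ∀ i, ¬ r i i) (htr : ∀ i j k, r i j → r j k → r i k)
    (x : Fin n → ℝ) {i j : Fin n} (h : r i j) : max (x j) (upMax r x j) ≤ upMax r x i := by
  refine max_le ((le_max_left _ _).trans (le_upMax r x h)) ?_
  rcases upMax_cases r x j with h0 | ⟨k, hk, h0⟩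
  · rw [h0]; exact upMax_nonneg r x i
  · rw [h0]; exact le_upMax r x (htr _ _ _ h hk)

end Transfer

lemma order_prop {n : ℕ} (P : PartialOrder (Fin n)) {o : Fin n → ℝ} (ho : o ∈ orderPolytope P) :
    (∀ i j, P.lt i j → o j ≤ o i) ∧ (∀ i, o i ≤ 1) := by
  have : orderPolytope P ⊆ {o | (∀ i j, P.lt i j → o j ≤ o i) ∧ (∀ i, o i ≤ 1)} := by
    refine convexHull_min ?_ ?_
    · rintro x ⟨I, hI, rfl⟩
      refine ⟨fun i j hij => ?_, fun i => ?_⟩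
      · have hle : P.le i j := ((P.lt_iff_le_not_ge i j).1 hij).1
        by_cases hj : j ∈ I
        · simp [indicator, hj, hI j hj i hle]
        · simp only [indicator, Set.indicator_of_notMem hj]
          exact Set.indicator_nonneg (fun _ _ => zero_le_one) _
      · exact Set.indicator_le_self' (fun _ _ => zero_le_one) i
    · rintro x ⟨hx, hx1⟩ y ⟨hy, hy1⟩ a b ha hb hab
      refine ⟨fun i j hij => ?_, fun i => ?_⟩
      · have h1 := mul_le_mul_of_nonneg_left (hx i j hij) ha
        have h2 := mul_le_mul_of_nonneg_left (hy i j hij) hb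
        simp only [Pi.add_apply, Pi.smul_apply, smul_eq_mul]
        linarith
      · have h1 := mul_le_mul_of_nonneg_left (hx1 i) ha
        have h2 := mul_le_mul_of_nonneg_left (hy1 i) hb
        simp only [Pi.add_apply, Pi.smul_apply, smul_eq_mul]
        linarith
  exact this ho

lemma chain_prop {n : ℕ} (P : PartialOrder (Fin n)) {c : Fin n → ℝ} (hc : c ∈ chainPolytope P) :
    ∃ g : Fin n → ℝ, (∀ i, c i ≤ g i) ∧ (∀ i, g i ≤ 1) ∧
      (∀ i j, P.lt i j → c i + g j ≤ g i) := by
  have : chainPolytope P ⊆ {c | ∃ g : Fin n → ℝ, (∀ i, c i ≤ g i) ∧ (∀ i, g i ≤ 1) ∧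
      (∀ i j, P.lt i j → c i + g j ≤ g i)} := by
    refine convexHull_min ?_ ?_
    · rintro x ⟨A, hA, rfl⟩
      have h01 : ∀ S : Set (Fin n), ∀ i, 0 ≤ indicator S i ∧ indicator S i ≤ 1 := fun S i =>
        ⟨Set.indicator_nonneg (fun _ _ => zero_le_one) _,
          Set.indicator_le_self' (fun _ _ => zero_le_one) i⟩
      have hmem : ∀ i, i ∈ A → i ∈ {i | ∃ a ∈ A, P.le i a} := fun i hi => ⟨i, hi, P.le_refl i⟩
      refine ⟨indicator {i | ∃ a ∈ A, P.le i a}, fun i => ?_, fun i => (h01 _ i).2,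
        fun i j hij => ?_⟩
      · by_cases hi : i ∈ A
        · have := hmem i hi
          simp only [indicator, Set.indicator_of_mem hi, Set.indicator_of_mem this]
          exact le_rfl
        · have := (h01 {i | ∃ a ∈ A, P.le i a} i).1
          simpa only [indicator, Set.indicator_of_notMem hi] using this
      · have hle : P.le i j := ((P.lt_iff_le_not_ge i j).1 hij).1
        have hnle : ¬ P.le j i := ((P.lt_iff_le_not_ge i j).1 hij).2
        by_cases hj : j ∈ {i | ∃ a ∈ A, P.le i a}
        · obtain ⟨a, ha, hja⟩ := hj
          have hia : P.le i a := P.le_trans _ _ _ hle hja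
          have hi : i ∉ A := by
            intro hi
            have hne : i ≠ a := by
              rintro rfl
              exact hnle hja
            exact (hA i hi a ha hne).1 hia
          have hi' : i ∈ {i | ∃ a ∈ A, P.le i a} := ⟨a, ha, hia⟩
          have h2 := (h01 {i | ∃ a ∈ A, P.le i a} j).2
          have e1 : indicator {i | ∃ a ∈ A, P.le i a} i = 1 := Set.indicator_of_mem hi' _
          have e2 : indicator A i = 0 := Set.indicator_of_notMem hi _
          linarith
        · have e1 : indicator {i | ∃ a ∈ A, P.le i a} j = 0 := Set.indicator_of_notMem hj _
          rw [e1, add_zero]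
          by_cases hi : i ∈ A
          · have e2 : indicator {i | ∃ a ∈ A, P.le i a} i = 1 :=
              Set.indicator_of_mem (hmem i hi) _
            rw [e2]
            exact (h01 A i).2
          · have e2 : indicator A i = 0 := Set.indicator_of_notMem hi _
            rw [e2]
            exact (h01 _ i).1
    · rintro x ⟨g, hx1, hx2, hx3⟩ y ⟨k, hy1, hy2, hy3⟩ a b ha hb hab
      refine ⟨a • g + b • k, fun i => ?_, fun i => ?_, fun i j hij => ?_⟩
      · have h1 := mul_le_mul_of_nonneg_left (hx1 i) ha
        have h2 := mul_le_mul_of_nonneg_left (hy1 i) hb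
        simp only [Pi.add_apply, Pi.smul_apply, smul_eq_mul]
        linarith
      · have h1 := mul_le_mul_of_nonneg_left (hx2 i) ha
        have h2 := mul_le_mul_of_nonneg_left (hy2 i) hb
        simp only [Pi.add_apply, Pi.smul_apply, smul_eq_mul]
        linarith
      · have h1 := mul_le_mul_of_nonneg_left (hx3 i j hij) ha
        have h2 := mul_le_mul_of_nonneg_left (hy3 i j hij) hb
        simp only [Pi.add_apply, Pi.smul_apply, smul_eq_mul]
        linarith
  exact this hc

lemma lt_irr {n : ℕ} (P : PartialOrder (Fin n)) : ∀ i, ¬ P.lt i i :=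
  fun i => @lt_irrefl _ P.toPreorder i

lemma lt_tr {n : ℕ} (P : PartialOrder (Fin n)) : ∀ i j k, P.lt i j → P.lt j k → P.lt i k :=
  fun _ _ _ h1 h2 => @lt_trans _ P.toPreorder _ _ _ h1 h2

/-- Scaled anti-blocking. -/
lemma stable_scale {n : ℕ} (G : SimpleGraph (Fin n)) {q b : Fin n → ℝ} {t : ℝ} (ht : 0 ≤ t)
    (hq : q ∈ stableSetPolytope G) (h0 : ∀ i, 0 ≤ b i) (h1 : ∀ i, b i ≤ t * q i) :
    ∃ q' ∈ stableSetPolytope G, b = t • q' := by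
  rcases ht.eq_or_lt with rfl | ht
  · refine ⟨q, hq, ?_⟩
    funext i
    have := h0 i
    have := h1 i
    simp; linarith
  · refine ⟨fun i => b i / t, ?_, ?_⟩
    · refine hullOf_down (IsStableSet G) ?_ hq (fun i => div_nonneg (h0 i) ht.le) ?_
      · intro S T hST hT i hi j hj
        exact hT i (hST hi) j (hST hj)
      · intro i
        rw [div_le_iff₀ ht, mul_comm]
        exact h1 i
    · funext i
      simp; field_simp

/-- Scaled layer-cake membership. -/
lemma layer_scale {n : ℕ} (p : Set (Fin n) → Prop) (hp : p ∅) (l u : Fin n → ℝ) {s : ℝ}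
    (hs : 0 ≤ s) (hl : ∀ i, 0 ≤ l i) (hlu : ∀ i, l i ≤ u i) (hu : ∀ i, u i ≤ s)
    (h : ∀ θ : ℝ, 0 < θ → p {i | l i < θ ∧ θ ≤ u i}) :
    ∃ c ∈ hullOf p, (fun i => u i - l i) = s • c := by
  rcases hs.eq_or_lt with rfl | hs
  · refine ⟨0, hullOf_zero p hp, ?_⟩
    funext i
    have := hl i
    have := hlu i
    have := hu i
    simp; linarith
  · refine ⟨fun i => u i / s - l i / s, ?_, ?_⟩
    · refine layer_hull p _ _ (fun i => div_nonneg (hl i) hs.le)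
        (fun i => div_le_div_of_nonneg_right (hlu i) hs.le)
        (fun i => (div_le_one hs).2 (hu i)) ?_
      intro θ h0 _
      have := h (θ * s) (mul_pos h0 hs)
      simpa only [div_lt_iff₀ hs, le_div_iff₀ hs] using this
    · funext i
      simp; field_simp

lemma psi_mem {n : ℕ} (P : PartialOrder (Fin n)) (G : SimpleGraph (Fin n)) (x : Fin n → ℝ) :
    psi P.lt x ∈ gammaPolytope (chainPolytope P) (stableSetPolytope G) ↔
      x ∈ gammaPolytope (orderPolytope P) (stableSetPolytope G) := by
  have hAe : IsPosetAntichain P ∅ := fun i hi => hi.elim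
  have hIe : IsPosetIdeal P ∅ := fun i hi => hi.elim
  have hSe : IsStableSet G ∅ := fun i hi => hi.elim
  have hirr := lt_irr P
  have htr := lt_tr P
  change psi P.lt x ∈ gammaPolytope (hullOf (IsPosetAntichain P)) (hullOf (IsStableSet G)) ↔
    x ∈ gammaPolytope (hullOf (IsPosetIdeal P)) (hullOf (IsStableSet G))
  rw [mem_gamma (hullOf_convex (IsPosetAntichain P)) (hullOf_convex (IsStableSet G))
      (hullOf_zero (IsPosetAntichain P) hAe) (hullOf_zero (IsStableSet G) hSe),
    mem_gamma (hullOf_convex (IsPosetIdeal P)) (hullOf_convex (IsStableSet G))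
      (hullOf_zero (IsPosetIdeal P) hIe) (hullOf_zero (IsStableSet G) hSe)]
  set M := upMax P.lt x with hM
  let a : Fin n → ℝ := fun i => max (x i) (M i)
  have hM0 : ∀ i, 0 ≤ M i := upMax_nonneg P.lt x
  have hMa : ∀ i, M i ≤ a i := fun i => le_max_right _ _
  have hxa : ∀ i, x i ≤ a i := fun i => le_max_left _ _
  have haM : ∀ i j, P.lt i j → a j ≤ M i := fun i j h => upMax_anti P.lt hirr htr x h
  have hMcases : ∀ i, M i = 0 ∨ ∃ j, P.lt i j ∧ M i ≤ a j := by
    intro i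
    rcases upMax_cases P.lt x i with h | ⟨j, hj, h⟩
    · exact Or.inl h
    · refine Or.inr ⟨j, hj, ?_⟩
      rw [hM, h]
      exact max_le_max le_rfl (hM0 j)
  constructor
  · rintro ⟨s, t, hs, ht, hst, c, hc, q, hq, hz⟩
    have hc0 := hullOf_nonneg _ hc
    have hq0 := hullOf_nonneg _ hq
    have hz' : ∀ i, x i - M i = s * c i - t * q i := fun i => congrFun hz i
    obtain ⟨g, hg1, hg2, hg3⟩ := chain_prop P hc
    have hac : ∀ i, a i ≤ M i + s * c i := by
      intro i
      have h1 := mul_nonneg hs (hc0 i)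
      have h2 := mul_nonneg ht (hq0 i)
      have h3 := hz' i
      exact max_le (by linarith) (by linarith)
    have hag : ∀ i, a i ≤ s * g i := by
      intro i
      induction i using (wf_flip P.lt hirr htr).induction with
      | _ i ih =>
        have h1 := hac i
        rcases hMcases i with h | ⟨j, hj, h⟩
        · have := mul_le_mul_of_nonneg_left (hg1 i) hs
          linarith
        · have h2 := mul_le_mul_of_nonneg_left (hg3 i j hj) hs
          have h3 := ih j hj
          linarith
    have has : ∀ i, a i ≤ s := by
      intro i
      have h1 := mul_le_mul_of_nonneg_left (hg2 i) hs
      have := hag i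
      linarith
    obtain ⟨o, ho, hao⟩ := layer_scale (IsPosetIdeal P) hIe (fun _ => 0) a hs (fun _ => le_rfl)
      (fun i => (hM0 i).trans (hMa i)) has (by
        rintro θ hθ i ⟨-, hi⟩ j hji
        refine ⟨hθ, hi.trans ?_⟩
        by_cases hij : P.le i j
        · rw [P.le_antisymm _ _ hij hji]
        · exact (haM j i ((P.lt_iff_le_not_ge j i).2 ⟨hji, hij⟩)).trans (hMa j))
    obtain ⟨q', hq', hb⟩ := stable_scale G (b := fun i => a i - x i) ht hq
      (fun i => sub_nonneg.2 (hxa i)) (by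
        intro i
        have h1 := mul_nonneg hs (hc0 i)
        have h2 := mul_nonneg ht (hq0 i)
        have h3 := hz' i
        have : a i ≤ x i + t * q i := max_le (by linarith) (by linarith)
        linarith)
    refine ⟨s, t, hs, ht, hst, o, ho, q', hq', ?_⟩
    rw [← hao, ← hb]
    funext i
    simp
  · rintro ⟨s, t, hs, ht, hst, o, ho, q, hq, hx⟩
    have ho0 := hullOf_nonneg _ ho
    have hq0 := hullOf_nonneg _ hq
    have hx' : ∀ i, x i = s * o i - t * q i := fun i => congrFun hx i
    obtain ⟨ho1, ho2⟩ := order_prop P ho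
    have hxo : ∀ i, x i ≤ s * o i := by
      intro i
      have h2 := mul_nonneg ht (hq0 i)
      have := hx' i
      linarith
    have hMo : ∀ i, M i ≤ s * o i := by
      intro i
      rcases upMax_cases P.lt x i with h | ⟨j, hj, h⟩
      · rw [hM, h]; exact mul_nonneg hs (ho0 i)
      · rw [hM, h]
        exact max_le ((hxo j).trans (mul_le_mul_of_nonneg_left (ho1 i j hj) hs))
          (mul_nonneg hs (ho0 i))
    have hao : ∀ i, a i ≤ s * o i := fun i => max_le (hxo i) (hMo i)
    obtain ⟨c, hc, hac⟩ := layer_scale (IsPosetAntichain P) hAe M a hs hM0 hMa (by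
        intro i
        have h1 := mul_le_mul_of_nonneg_left (ho2 i) hs
        have := hao i
        linarith) (by
        rintro θ hθ i ⟨hi1, hi2⟩ j ⟨hj1, hj2⟩ hne
        constructor
        · intro hij
          have hlt : P.lt i j := (P.lt_iff_le_not_ge i j).2
            ⟨hij, fun h => hne (P.le_antisymm _ _ hij h)⟩
          have := haM i j hlt
          linarith
        · intro hji
          have hlt : P.lt j i := (P.lt_iff_le_not_ge j i).2
            ⟨hji, fun h => hne (P.le_antisymm _ _ h hji)⟩
          have := haM j i hlt
          linarith)
    obtain ⟨q', hq', hb⟩ := stable_scale G (b := fun i => a i - x i) ht hq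
      (fun i => sub_nonneg.2 (hxa i)) (by
        intro i
        have := hao i
        have := hx' i
        linarith)
    refine ⟨s, t, hs, ht, hst, c, hc, q', hq', ?_⟩
    rw [← hac, ← hb]
    funext i
    simp [psi, hM]

lemma count_eq {n : ℕ} (P : PartialOrder (Fin n)) (G : SimpleGraph (Fin n)) (m : ℕ)
    (hm : m ≠ 0) :
    latticePointCount ((m : ℝ) • gammaPolytope (orderPolytope P) (stableSetPolytope G)) =
    latticePointCount ((m : ℝ) • gammaPolytope (chainPolytope P) (stableSetPolytope G)) := by
  have hirr := lt_irr P
  have htr := lt_tr P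
  have hm' : (m : ℝ) ≠ 0 := by exact_mod_cast hm
  have key : ∀ x, psi P.lt x ∈ (m : ℝ) • gammaPolytope (chainPolytope P) (stableSetPolytope G) ↔
      x ∈ (m : ℝ) • gammaPolytope (orderPolytope P) (stableSetPolytope G) := by
    intro x
    rw [Set.mem_smul_set_iff_inv_smul_mem₀ hm', Set.mem_smul_set_iff_inv_smul_mem₀ hm',
      ← psi_smul P.lt (inv_nonneg.2 (Nat.cast_nonneg m)), psi_mem]
  unfold latticePointCount
  rw [← Set.ncard_image_of_injective _ (psi_injective P.lt hirr htr)]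
  congr 1
  ext z
  constructor
  · rintro ⟨x, ⟨h1, h2⟩, rfl⟩
    exact ⟨(key x).2 h1, (psi_lattice P.lt hirr htr x).2 h2⟩
  · rintro ⟨h1, h2⟩
    obtain ⟨x, rfl⟩ := psi_surjective P.lt hirr htr z
    exact ⟨x, ⟨(key x).1 h1, (psi_lattice P.lt hirr htr x).1 h2⟩, rfl⟩

/-- For a poset `P` on `[d]` and a perfect graph `G` on `[d]` (`d ≥ 1`),
`δ(Γ(O_P, Q_G), λ) = δ(Γ(C_P, Q_G), λ)`. -/
theorem delta_gamma_order_eq_chain (d : ℕ) (hd : 1 ≤ d) (P : PartialOrder (Fin d))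
    (G : SimpleGraph (Fin d)) (hG : IsPerfectGraph G) :
    deltaPolynomial (gammaPolytope (orderPolytope P) (stableSetPolytope G)) =
      deltaPolynomial (gammaPolytope (chainPolytope P) (stableSetPolytope G)) := by
  unfold deltaPolynomial ehrhartSeries
  congr 2
  funext m
  by_cases hm : m = 0
  · simp [hm]
  · simp only [hm, if_false]
    rw [count_eq P G m hm]

end HibiTsuchiya
end
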